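/- arXiv:1601.06574 — 10 statements merged into one kernel-verified Lean document; each statement's English description precedes it below -/
import Mathlib

section
/- Let d ∈ {4, 6, 8}, set N = binom(d/2+2,2), and let f ∈ ℝ[x,y,z] be homogeneous of degree d with det C(f) ≠ 0. Suppose that neither f nor −f is a sum of d-th powers of real linear forms, and that the anti-polar form Ω(f), defined by Ω(f)(a,b,c) = det C(f + (ax+by+cz)^d) − det C(f), satisfies Ω(f)(a,b,c) ≠ 0 for every (a,b,c) ∈ ℝ³ with (a,b,c) ≠ (0,0,0). Then f has no real Waring decomposition of length at most N; that is, rrk(f) > N. -/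
open MvPolynomial

/-- The iterated partial derivative operator `∂x^(α 0) ∂y^(α 1) ∂z^(α 2)`. -/
noncomputable def applyD (α : Fin 3 →₀ ℕ) (f : MvPolynomial (Fin 3) ℝ) :
    MvPolynomial (Fin 3) ℝ :=
  (⇑(pderiv (0 : Fin 3)))^[α 0] ((⇑(pderiv (1 : Fin 3)))^[α 1] ((⇑(pderiv (2 : Fin 3)))^[α 2] f))

/-- The differential operator `p(∂)` applied to `f`:
`p(∂)f = ∑_α c_α ∂x^(α₁) ∂y^(α₂) ∂z^(α₃) f`. -/
noncomputable def diffOp (p f : MvPolynomial (Fin 3) ℝ) : MvPolynomial (Fin 3) ℝ :=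
  ∑ α ∈ p.support, p.coeff α • applyD α f

/-- The linear form `a·x + b·y + c·z`. -/
noncomputable def lin (a b c : ℝ) : MvPolynomial (Fin 3) ℝ :=
  C a * X 0 + C b * X 1 + C c * X 2

/-- Index type for the monomial basis `x^i y^j z^(k-i-j)` of ternary forms of degree `k`;
it has cardinality `binom(k+2,2)`. -/
abbrev CatIdx (k : ℕ) := {m : Fin (k + 1) × Fin (k + 1) // (m.1 : ℕ) + (m.2 : ℕ) ≤ k}

/-- The middle catalecticant matrix `C(f)` of `f` (for `f` of degree `2k`), in the monomial
basis of the space of ternary forms of degree `k`: its entry at a pair of monomials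
`p, q` of degree `k` is the constant `(p·q)(∂) f`. -/
noncomputable def catMatrix (k : ℕ) (f : MvPolynomial (Fin 3) ℝ) :
    Matrix (CatIdx k) (CatIdx k) ℝ :=
  Matrix.of fun m m' =>
    MvPolynomial.coeff 0 (diffOp
      (X 0 ^ ((m.1.1 : ℕ) + (m'.1.1 : ℕ)) * X 1 ^ ((m.1.2 : ℕ) + (m'.1.2 : ℕ)) *
        X 2 ^ ((k - m.1.1 - m.1.2) + (k - m'.1.1 - m'.1.2))) f)

/-- The evaluations at `(a, b, c)` of the monomials of degree `k`. -/
def monomialVec (k : ℕ) (a b c : ℝ) (m : CatIdx k) : ℝ :=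
  a ^ (m.1.1 : ℕ) * b ^ (m.1.2 : ℕ) * c ^ (k - m.1.1 - m.1.2)

theorem pderiv_lin (a b c : ℝ) (i : Fin 3) : pderiv i (lin a b c) = C (![a, b, c] i) := by
  fin_cases i <;> simp [lin, pderiv_X]

theorem iterate_pderiv_smul_lin_pow (a b c : ℝ) (i : Fin 3) (m n : ℕ) (t : ℝ) :
    (⇑(pderiv i))^[m] ((t / (m + n).factorial) • lin a b c ^ (m + n)) =
      (t * (![a, b, c] i) ^ m / n.factorial) • lin a b c ^ n := by
  induction m generalizing t with
  | zero => simp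
  | succ m ih =>
    have h : pderiv i ((t / (m + 1 + n).factorial) • lin a b c ^ (m + 1 + n)) =
        ((t * ![a, b, c] i) / (m + n).factorial) • lin a b c ^ (m + n) := by
      rw [show m + 1 + n = (m + n) + 1 by ring, Derivation.map_smul, Derivation.leibniz_pow,
        pderiv_lin, Nat.factorial_succ]
      simp only [smul_eq_C_mul, nsmul_eq_mul, smul_eq_mul, Nat.add_sub_cancel]
      have h1 : ((m + n + 1 : ℕ) : MvPolynomial (Fin 3) ℝ) = C ((m + n + 1 : ℕ) : ℝ) := by simp
      rw [h1, mul_comm (lin a b c ^ (m + n)), ← mul_assoc, ← mul_assoc, ← C_mul, ← C_mul]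
      congr 2
      have : ((m + n + 1 : ℕ) : ℝ) ≠ 0 := by positivity
      push_cast at this ⊢
      field_simp
    rw [Function.iterate_succ_apply, h, ih, pow_succ']
    ring_nf

/-- `applyD` as a linear map. -/
noncomputable def applyDLin (α : Fin 3 →₀ ℕ) :
    MvPolynomial (Fin 3) ℝ →ₗ[ℝ] MvPolynomial (Fin 3) ℝ :=
  (pderiv (0 : Fin 3)).toLinearMap ^ (α 0) * (pderiv (1 : Fin 3)).toLinearMap ^ (α 1) *
    (pderiv (2 : Fin 3)).toLinearMap ^ (α 2)

theorem applyDLin_apply (α : Fin 3 →₀ ℕ) (f : MvPolynomial (Fin 3) ℝ) :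
    applyDLin α f = applyD α f := by
  simp [applyDLin, applyD, Module.End.mul_apply, Module.End.pow_apply]

theorem applyD_lin_pow (α : Fin 3 →₀ ℕ) (a b c : ℝ) :
    applyD α (lin a b c ^ (α 0 + α 1 + α 2)) =
      C ((α 0 + α 1 + α 2).factorial * (a ^ α 0 * b ^ α 1 * c ^ α 2)) := by
  have hn : ((α 0 + α 1 + α 2).factorial : ℝ) ≠ 0 := by positivity
  have h : lin a b c ^ (α 0 + α 1 + α 2) =
      (((α 0 + α 1 + α 2).factorial : ℝ) / (α 2 + (α 1 + (α 0 + 0))).factorial) •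
        lin a b c ^ (α 2 + (α 1 + (α 0 + 0))) := by
    rw [show α 2 + (α 1 + (α 0 + 0)) = α 0 + α 1 + α 2 by ring, div_self hn, one_smul]
  unfold applyD
  rw [h, iterate_pderiv_smul_lin_pow, iterate_pderiv_smul_lin_pow, iterate_pderiv_smul_lin_pow]
  simp only [smul_eq_C_mul, pow_zero, mul_one]
  congr 1
  simp
  ring

theorem diffOp_X_pow (p q s : ℕ) (f : MvPolynomial (Fin 3) ℝ) :
    ∃ α : Fin 3 →₀ ℕ, α 0 = p ∧ α 1 = q ∧ α 2 = s ∧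
      diffOp (X 0 ^ p * X 1 ^ q * X 2 ^ s) f = applyDLin α f := by
  refine ⟨Finsupp.single 0 p + Finsupp.single 1 q + Finsupp.single 2 s, by simp, by simp,
    by simp, ?_⟩
  have h : (X 0 ^ p * X 1 ^ q * X 2 ^ s : MvPolynomial (Fin 3) ℝ) =
      monomial (Finsupp.single 0 p + Finsupp.single 1 q + Finsupp.single 2 s) 1 := by
    simp [X_pow_eq_monomial, monomial_mul]
  rw [h, diffOp, support_monomial, if_neg one_ne_zero, Finset.sum_singleton, coeff_monomial,
    if_pos rfl, one_smul, applyDLin_apply]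

theorem catMatrix_add (k : ℕ) (f g : MvPolynomial (Fin 3) ℝ) :
    catMatrix k (f + g) = catMatrix k f + catMatrix k g := by
  ext m m'
  simp only [catMatrix, Matrix.of_apply, Matrix.add_apply, diffOp, ← applyDLin_apply, map_add,
    smul_add, Finset.sum_add_distrib, coeff_add]

theorem catMatrix_smul (k : ℕ) (t : ℝ) (f : MvPolynomial (Fin 3) ℝ) :
    catMatrix k (t • f) = t • catMatrix k f := by
  ext m m'
  simp only [catMatrix, Matrix.of_apply, Matrix.smul_apply, diffOp, ← applyDLin_apply, map_smul,
    smul_comm _ t, ← Finset.smul_sum, coeff_smul]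

/-- `catMatrix` as a linear map. -/
noncomputable def catMatrixLin (k : ℕ) :
    MvPolynomial (Fin 3) ℝ →ₗ[ℝ] Matrix (CatIdx k) (CatIdx k) ℝ where
  toFun := catMatrix k
  map_add' := catMatrix_add k
  map_smul' := catMatrix_smul k

theorem catMatrix_lin_pow (k : ℕ) (a b c : ℝ) (m m' : CatIdx k) :
    catMatrix k (lin a b c ^ (2 * k)) m m' =
      (2 * k).factorial * (monomialVec k a b c m * monomialVec k a b c m') := by
  obtain ⟨⟨m₁, m₂⟩, hm⟩ := m
  obtain ⟨⟨n₁, n₂⟩, hn⟩ := m'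
  simp only at hm hn
  simp only [catMatrix, Matrix.of_apply, monomialVec]
  obtain ⟨α, h0, h1, h2, h⟩ := diffOp_X_pow ((m₁ : ℕ) + n₁) ((m₂ : ℕ) + n₂)
    ((k - m₁ - m₂) + (k - n₁ - n₂)) (lin a b c ^ (2 * k))
  have hα : 2 * k = α 0 + α 1 + α 2 := by omega
  rw [h, applyDLin_apply, hα, applyD_lin_pow, coeff_zero_C, h0, h1, h2]
  ring

theorem catMatrix_sum_smul_lin_pow (k r : ℕ) (lam a b c : Fin r → ℝ) :
    catMatrix k (∑ i, lam i • lin (a i) (b i) (c i) ^ (2 * k)) =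
      Matrix.of (fun m i => monomialVec k (a i) (b i) (c i) m) *
        (Matrix.diagonal (fun i => (2 * k).factorial * lam i) *
          (Matrix.of (fun m i => monomialVec k (a i) (b i) (c i) m)).transpose) := by
  change catMatrixLin k _ = _
  ext m m'
  rw [Matrix.mul_apply]
  simp only [map_sum, map_smul, Matrix.sum_apply, Matrix.smul_apply, Matrix.diagonal_mul,
    Matrix.transpose_apply, Matrix.of_apply]
  refine Finset.sum_congr rfl fun i _ => ?_
  change lam i • catMatrix k _ m m' = _
  rw [catMatrix_lin_pow, smul_eq_mul]
  ring

theorem card_le_of_det_catMatrix_ne_zero (k r : ℕ) (lam a b c : Fin r → ℝ)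
    (h : (catMatrix k (∑ i, lam i • lin (a i) (b i) (c i) ^ (2 * k))).det ≠ 0) :
    Fintype.card (CatIdx k) ≤ r := by
  rw [← Matrix.rank_of_isUnit _ ((Matrix.isUnit_iff_isUnit_det _).2 h.isUnit),
    catMatrix_sum_smul_lin_pow]
  exact (Matrix.rank_mul_le_left _ _).trans ((Matrix.rank_le_card_width _).trans (by simp))

theorem exists_det_catMatrix_eq_mul_prod (k r : ℕ) (hr : Fintype.card (CatIdx k) = r)
    (a b c : Fin r → ℝ) :
    ∃ K : ℝ, ∀ lam : Fin r → ℝ,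
      (catMatrix k (∑ i, lam i • lin (a i) (b i) (c i) ^ (2 * k))).det = K * ∏ i, lam i := by
  let e : CatIdx k ≃ Fin r := Fintype.equivFinOfCardEq hr
  let W : Matrix (Fin r) (Fin r) ℝ :=
    Matrix.of fun j i => monomialVec k (a i) (b i) (c i) (e.symm j)
  refine ⟨W.det * (∏ _i : Fin r, ((2 * k).factorial : ℝ)) * W.det, fun lam => ?_⟩
  have h : Matrix.reindex e e
      (catMatrix k (∑ i, lam i • lin (a i) (b i) (c i) ^ (2 * k))) =
      W * (Matrix.diagonal (fun i => (2 * k).factorial * lam i) * W.transpose) := by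
    rw [catMatrix_sum_smul_lin_pow]
    rfl
  rw [← Matrix.det_reindex_self e, h, Matrix.det_mul, Matrix.det_mul, Matrix.det_transpose,
    Matrix.det_diagonal, Finset.prod_mul_distrib]
  ring

/-- Evaluated at one of the linear forms of a decomposition of minimal length, the anti-polar
form is the determinant of the catalecticant divided by the coefficient of that linear form. -/
theorem antipolar_mul_coeff (k r : ℕ) (hr : Fintype.card (CatIdx k) = r)
    (lam a b c : Fin r → ℝ) (f : MvPolynomial (Fin 3) ℝ)
    (hf : f = ∑ i, lam i • lin (a i) (b i) (c i) ^ (2 * k)) (i : Fin r) :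
    ((catMatrix k (f + lin (a i) (b i) (c i) ^ (2 * k))).det - (catMatrix k f).det) * lam i =
      (catMatrix k f).det := by
  obtain ⟨K, hK⟩ := exists_det_catMatrix_eq_mul_prod k r hr a b c
  have h : f + lin (a i) (b i) (c i) ^ (2 * k) =
      ∑ j, Function.update lam i (lam i + 1) j • lin (a j) (b j) (c j) ^ (2 * k) := by
    rw [hf, ← Finset.add_sum_erase _ _ (Finset.mem_univ i),
      ← Finset.add_sum_erase _ (fun j => Function.update lam i (lam i + 1) j • _)
        (Finset.mem_univ i), Function.update_self, add_smul, one_smul, add_right_comm]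
    congr 1
    refine Finset.sum_congr rfl fun j hj => ?_
    rw [Function.update_of_ne (Finset.ne_of_mem_erase hj)]
  rw [h, hf, hK, hK, Finset.prod_update_of_mem (Finset.mem_univ i),
    Fintype.prod_eq_mul_prod_compl i lam, Finset.compl_eq_univ_sdiff]
  ring

theorem continuous_det_catMatrix_add_lin_pow (k : ℕ) (f : MvPolynomial (Fin 3) ℝ) :
    Continuous fun p : ℝ × ℝ × ℝ =>
      (catMatrix k (f + lin p.1 p.2.1 p.2.2 ^ (2 * k))).det := by
  refine Continuous.matrix_det (continuous_matrix fun m m' => ?_)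
  simp only [catMatrix_add, Matrix.add_apply, catMatrix_lin_pow, monomialVec]
  fun_prop

/-- A continuous function without zeros on a preconnected set has constant sign. -/
theorem IsPreconnected.pos_or_neg_of_ne_zero {E : Type*} [TopologicalSpace E] {s : Set E}
    (hs : IsPreconnected s) {g : E → ℝ} (hg : ContinuousOn g s) (h0 : ∀ p ∈ s, g p ≠ 0) :
    (∀ p ∈ s, 0 < g p) ∨ ∀ p ∈ s, g p < 0 := by
  by_contra! h
  obtain ⟨⟨p, hp, hgp⟩, q, hq, hgq⟩ := h
  obtain ⟨x, hx, hgx⟩ := hs.intermediate_value hp hq hg ⟨hgp, hgq⟩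
  exact h0 x hx hgx

theorem exists_eq_sum_lin_pow_of_pos {d r : ℕ} (hd : d ≠ 0) (lam a b c : Fin r → ℝ)
    (hlam : ∀ i, 0 < lam i) :
    ∃ (k : ℕ) (a' b' c' : Fin k → ℝ),
      ∑ i, lam i • lin (a i) (b i) (c i) ^ d = ∑ j, lin (a' j) (b' j) (c' j) ^ d := by
  refine ⟨r, fun i => lam i ^ (d⁻¹ : ℝ) * a i, fun i => lam i ^ (d⁻¹ : ℝ) * b i,
    fun i => lam i ^ (d⁻¹ : ℝ) * c i, Finset.sum_congr rfl fun i _ => ?_⟩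
  have h : ∀ t : ℝ, lin (t * a i) (t * b i) (t * c i) = C t * lin (a i) (b i) (c i) := by
    intro t
    simp only [lin, C_mul]
    ring
  rw [h, mul_pow, ← C_pow, Real.rpow_inv_natCast_pow (hlam i).le hd, smul_eq_C_mul]

theorem card_catIdx {k : ℕ} (hk : k = 2 ∨ k = 3 ∨ k = 4) :
    Fintype.card (CatIdx k) = Nat.choose (k + 2) 2 := by
  rcases hk with rfl | rfl | rfl <;> decide

/-- Let `d ∈ {4,6,8}`, `N = binom(d/2+2,2)`, and let `f` be a ternary form of
degree `d` with `det C(f) ≠ 0`. If neither `f` nor `-f` is a sum of `d`-th powers of real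
linear forms, and the anti-polar form
`Ω(f)(a,b,c) = det C(f + (ax+by+cz)^d) − det C(f)` has no nonzero real zero, then `f` has
no real Waring decomposition of length at most `N`, i.e. `rrk(f) > N`. -/
theorem statement5 (d : ℕ) (hd : d = 4 ∨ d = 6 ∨ d = 8) (f : MvPolynomial (Fin 3) ℝ)
    (hf : f.IsHomogeneous d)
    (hdet : (catMatrix (d / 2) f).det ≠ 0)
    (hP1 : ¬ ∃ (k : ℕ) (a b c : Fin k → ℝ), f = ∑ j, lin (a j) (b j) (c j) ^ d)
    (hP2 : ¬ ∃ (k : ℕ) (a b c : Fin k → ℝ), -f = ∑ j, lin (a j) (b j) (c j) ^ d)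
    (hOm : ∀ a b c : ℝ, (a, b, c) ≠ (0, 0, 0) →
      (catMatrix (d / 2) (f + lin a b c ^ d)).det - (catMatrix (d / 2) f).det ≠ 0) :
    ∀ (r : ℕ) (lam a b c : Fin r → ℝ),
      f = ∑ i, lam i • lin (a i) (b i) (c i) ^ d → Nat.choose (d / 2 + 2) 2 < r := by
  intro r lam a b c hdec
  by_contra! hr
  obtain ⟨k, hk, rfl⟩ : ∃ k, (k = 2 ∨ k = 3 ∨ k = 4) ∧ d = 2 * k := by
    rcases hd with rfl | rfl | rfl
    exacts [⟨2, by simp⟩, ⟨3, by simp⟩, ⟨4, by simp⟩]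
  have hk0 : 2 * k ≠ 0 := by omega
  rw [Nat.mul_div_cancel_left k two_pos] at hdet hOm hr
  have hcard : Fintype.card (CatIdx k) = r := by
    refine le_antisymm (card_le_of_det_catMatrix_ne_zero k r lam a b c (hdec ▸ hdet)) ?_
    rwa [card_catIdx hk]
  have key := antipolar_mul_coeff k r hcard lam a b c f hdec
  have hne : ∀ i, (a i, b i, c i) ≠ ((0, 0, 0) : ℝ × ℝ × ℝ) := by
    intro i h
    simp only [Prod.mk.injEq] at h
    obtain ⟨ha, hb, hc⟩ := h
    refine hdet ((key i).symm.trans ?_)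
    simp [ha, hb, hc, lin, hk0]
  have hconn : IsPreconnected ({((0, 0, 0) : ℝ × ℝ × ℝ)}ᶜ) :=
    (isConnected_compl_singleton_of_one_lt_rank
      (by rw [← Module.finrank_eq_rank]; norm_num) _).isPreconnected
  have hsign := hconn.pos_or_neg_of_ne_zero
    (g := fun p => ((catMatrix k (f + lin p.1 p.2.1 p.2.2 ^ (2 * k))).det -
      (catMatrix k f).det) * (catMatrix k f).det)
    (((continuous_det_catMatrix_add_lin_pow k f).sub continuous_const).mul
      continuous_const).continuousOn
    (fun p hp => mul_ne_zero (hOm p.1 p.2.1 p.2.2 hp) hdet)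
  have hpos : ∀ i, 0 < ((catMatrix k (f + lin (a i) (b i) (c i) ^ (2 * k))).det -
      (catMatrix k f).det) * (catMatrix k f).det * lam i := by
    intro i
    rw [mul_right_comm, key i]
    exact mul_self_pos.2 hdet
  rcases hsign with h | h
  · refine hP1 ?_
    rw [hdec]
    exact exists_eq_sum_lin_pow_of_pos hk0 lam a b c
      fun i => (pos_iff_pos_of_mul_pos (hpos i)).1 (h (a i, b i, c i) (hne i))
  · refine hP2 ?_
    have hneg : -f = ∑ i, (-lam i) • lin (a i) (b i) (c i) ^ (2 * k) := by
      simp [hdec]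
    rw [hneg]
    exact exists_eq_sum_lin_pow_of_pos hk0 _ a b c
      fun i => neg_pos.2 ((neg_iff_neg_of_mul_pos (hpos i)).1 (h (a i, b i, c i) (hne i)))
end

section
/- For every real number λ, the following identity holds in ℝ[x,y,z]: 24(λ+3)²(x³ + y³ + z³ + λxyz) = ((6+λ)x − λy − λz)³ + ((6+λ)y − λx − λz)³ + ((6+λ)z − λx − λy)³ + λ(λ² + 6λ + 36)(x + y + z)³. -/
open MvPolynomial

/-- For every real `λ`, in `ℝ[x,y,z]` one has
`24(λ+3)²(x³+y³+z³+λxyz) = ((6+λ)x−λy−λz)³ + ((6+λ)y−λx−λz)³ + ((6+λ)z−λx−λy)³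
+ λ(λ²+6λ+36)(x+y+z)³`. -/
theorem statement6 (l : ℝ) :
    C (24 * (l + 3) ^ 2) *
        ((X 0 : MvPolynomial (Fin 3) ℝ) ^ 3 + X 1 ^ 3 + X 2 ^ 3 + C l * (X 0 * X 1 * X 2)) =
      (C (6 + l) * X 0 - C l * X 1 - C l * X 2) ^ 3
        + (C (6 + l) * X 1 - C l * X 0 - C l * X 2) ^ 3
        + (C (6 + l) * X 2 - C l * X 0 - C l * X 1) ^ 3
        + C (l * (l ^ 2 + 6 * l + 36)) * (X 0 + X 1 + X 2) ^ 3 := by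
  simp only [map_mul, map_add, map_pow, map_ofNat]
  ring
end

section
/- For every real number λ ≠ −3, the ternary cubic x³ + y³ + z³ + λxyz has real rank at most 4; that is, there exist real numbers λ_1, …, λ_4 and real linear forms ℓ_1, …, ℓ_4 with x³ + y³ + z³ + λxyz = ∑_{i=1}^4 λ_i ℓ_i³. -/
open MvPolynomial

/-- For every real `λ ≠ −3`, the ternary cubic `x³+y³+z³+λxyz` has real rank
at most 4: it is a real linear combination of cubes of 4 real linear forms. -/
theorem statement7 (l : ℝ) (hl : l ≠ -3) :
    ∃ (lam a b c : Fin 4 → ℝ),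
      ((X 0 : MvPolynomial (Fin 3) ℝ) ^ 3 + X 1 ^ 3 + X 2 ^ 3 + C l * (X 0 * X 1 * X 2)) =
        ∑ i, lam i • lin (a i) (b i) (c i) ^ 3 := by
  have h3 : l + 3 ≠ 0 := fun h => hl (by linarith)
  refine ⟨![l * (l ^ 2 + 6 * l + 36) / (24 * (l + 3) ^ 2), -1 / (24 * (l + 3) ^ 2),
      -1 / (24 * (l + 3) ^ 2), -1 / (24 * (l + 3) ^ 2)],
    ![1, -(l + 6), l, l], ![1, l, -(l + 6), l], ![1, l, l, -(l + 6)], ?_⟩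
  refine MvPolynomial.funext fun v => ?_
  simp [Fin.sum_univ_four, lin, smul_eval]
  field_simp
  ring
end

section
/- Let ℓ_1, ℓ_2, ℓ_3, ℓ_4 be real linear forms in x, y, z and let f = ℓ_1³ + ℓ_2³ + ℓ_3³ + ℓ_4³. Suppose the apolar ideal f^⊥ is generated, as an ideal of ℝ[x,y,z], by three homogeneous quadrics. Then any three of the linear forms ℓ_1, ℓ_2, ℓ_3, ℓ_4 are linearly independent. -/
open MvPolynomial

/-- Linear forms in three variables, parametrised by their coefficient vectors. -/
noncomputable def linearForm (v : Fin 3 → ℝ) : MvPolynomial (Fin 3) ℝ := lin (v 0) (v 1) (v 2)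

lemma linearForm_isHomogeneous (v : Fin 3 → ℝ) : (linearForm v).IsHomogeneous 1 := by
  unfold linearForm lin
  exact (((isHomogeneous_C_mul_X _ _).add (isHomogeneous_C_mul_X _ _)).add
    (isHomogeneous_C_mul_X _ _))

lemma aeval_linearForm {A : Type*} [CommRing A] [Algebra ℝ A] (P : Fin 3 → A) (v : Fin 3 → ℝ) :
    aeval P (linearForm v) =
      algebraMap ℝ A (v 0) * P 0 + algebraMap ℝ A (v 1) * P 1 + algebraMap ℝ A (v 2) * P 2 := by
  simp [linearForm, lin]

lemma linearForm_smul_add_smul (s t : ℝ) (u w : Fin 3 → ℝ) :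
    linearForm (s • u + t • w) = C s * linearForm u + C t * linearForm w := by
  simp [linearForm, lin]
  ring

lemma linearForm_eq_zero {v : Fin 3 → ℝ} (h : linearForm v = 0) : v = 0 := by
  funext i
  have := congrArg (aeval (Pi.single i (1 : ℝ))) h
  rw [aeval_linearForm] at this
  fin_cases i <;> simpa using this

lemma pderiv_iterate_C_mul_pow (i : Fin 3) (v : Fin 3 → ℝ) (r : ℝ) (n k : ℕ) :
    (⇑(pderiv i))^[k] (C r * linearForm v ^ n) =
      C (r * n.descFactorial k * v i ^ k) * linearForm v ^ (n - k) := by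
  have h1 : pderiv i (linearForm v) = C (v i) := by
    fin_cases i <;> simp [linearForm, lin, pderiv_X]
  induction k with
  | zero => simp
  | succ k ih =>
    rw [Function.iterate_succ_apply', ih, pderiv_C_mul, Derivation.leibniz_pow, h1,
      Nat.descFactorial_succ, Nat.sub_sub]
    simp only [map_mul, map_pow, Nat.cast_mul, smul_eq_mul, nsmul_eq_mul, map_natCast]
    ring

lemma applyD_linearForm_pow (α : Fin 3 →₀ ℕ) (v : Fin 3 → ℝ) (n : ℕ) :
    applyD α (linearForm v ^ n) =
      C (n.descFactorial α.degree * (v 0 ^ α 0 * v 1 ^ α 1 * v 2 ^ α 2)) *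
        linearForm v ^ (n - α.degree) := by
  have hd : α.degree = α 2 + α 1 + α 0 := by
    rw [Finsupp.degree_eq_sum, Fin.sum_univ_three]; ring
  have h := pderiv_iterate_C_mul_pow 2 v 1 n (α 2)
  rw [C_1, one_mul] at h
  have e1 : n.descFactorial (α 2 + α 1 + α 0) = n.descFactorial (α 2) *
      (n - α 2).descFactorial (α 1) * (n - α 2 - α 1).descFactorial (α 0) := by
    rw [← Nat.descFactorial_mul_descFactorial (show α 2 + α 1 ≤ α 2 + α 1 + α 0 by lia),
      ← Nat.descFactorial_mul_descFactorial (show α 2 ≤ α 2 + α 1 by lia),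
      Nat.add_sub_cancel_left, Nat.add_sub_cancel_left, Nat.sub_sub]
    ring
  rw [applyD, h, pderiv_iterate_C_mul_pow, pderiv_iterate_C_mul_pow, hd, e1, Nat.sub_sub,
    Nat.sub_sub]
  congr 2
  push_cast
  ring

lemma applyD_sum {ι : Type*} (s : Finset ι) (α : Fin 3 →₀ ℕ) (g : ι → MvPolynomial (Fin 3) ℝ) :
    applyD α (∑ i ∈ s, g i) = ∑ i ∈ s, applyD α (g i) := by
  simp only [applyD, ← Derivation.coeFn_coe, ← Module.End.coe_pow, map_sum]

lemma diffOp_sum_linearForm_pow {ι : Type*} [Fintype ι] {p : MvPolynomial (Fin 3) ℝ} {d : ℕ}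
    (hp : p.IsHomogeneous d) (v : ι → Fin 3 → ℝ) (n : ℕ) :
    diffOp p (∑ i, linearForm (v i) ^ n) =
      ∑ i, C (n.descFactorial d * aeval (v i) p) * linearForm (v i) ^ (n - d) := by
  simp only [diffOp, applyD_sum, Finset.smul_sum]
  rw [Finset.sum_comm]
  refine Finset.sum_congr rfl fun i _ => ?_
  rw [aeval_def, eval₂_eq', Finset.mul_sum, map_sum, Finset.sum_mul]
  refine Finset.sum_congr rfl fun α hα => ?_
  have hd : α.degree = d := by
    rw [Finsupp.degree_eq_weight_one]
    exact hp (mem_support_iff.1 hα)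
  rw [applyD_linearForm_pow, hd, smul_eq_C_mul, ← mul_assoc, ← C_mul]
  congr 2
  simp [Fin.prod_univ_three]
  ring

lemma exists_eq_sum_C_mul_of_mem_span {σ R ι : Type*} [CommRing R] [Fintype ι]
    {q : ι → MvPolynomial σ R} {d : ℕ} (hq : ∀ t, (q t).IsHomogeneous d)
    {p : MvPolynomial σ R} (hp : p.IsHomogeneous d) (h : p ∈ Ideal.span (Set.range q)) :
    ∃ r : ι → R, p = ∑ t, C (r t) * q t := by
  obtain ⟨g, hg⟩ := Ideal.mem_span_range_iff_exists_fun.1 h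
  refine ⟨fun t => coeff 0 (g t), ?_⟩
  have key : ∀ t, homogeneousComponent d (g t * q t) = C (coeff 0 (g t)) * q t := by
    intro t
    let _ := gradedAlgebra (σ := σ) (R := R)
    have hc : ∀ φ i, (DirectSum.decompose (homogeneousSubmodule σ R) φ i : MvPolynomial σ R) =
        homogeneousComponent i φ := decomposition.decompose'_apply
    have := DirectSum.coe_decompose_mul_of_right_mem_of_le (homogeneousSubmodule σ R)
      (a := g t) (n := d) ((mem_homogeneousSubmodule d (q t)).2 (hq t)) le_rfl
    rwa [Nat.sub_self, hc, hc, homogeneousComponent_zero] at this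
  rw [← homogeneousComponent_of_mem hp |>.trans (if_pos rfl), ← hg, map_sum]
  exact Finset.sum_congr rfl fun t _ => key t

lemma exists_independent_orthogonal {K : Type*} [Field K] (v : Fin 3 → K) :
    ∃ u w : Fin 3 → K, v 0 * u 0 + v 1 * u 1 + v 2 * u 2 = 0 ∧
      v 0 * w 0 + v 1 * w 1 + v 2 * w 2 = 0 ∧
      ∀ s t : K, s • u + t • w = 0 → s = 0 ∧ t = 0 := by
  by_cases h0 : v 0 = 0
  · by_cases h1 : v 1 = 0
    · refine ⟨![1, 0, 0], ![0, 1, 0], by simp [h0], by simp [h1], fun s t h => ?_⟩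
      exact ⟨by simpa using congrFun h 0, by simpa using congrFun h 1⟩
    · refine ⟨![1, 0, 0], ![0, -v 2, v 1], by simp [h0], by simp; ring, fun s t h => ?_⟩
      exact ⟨by simpa using congrFun h 0, by simpa [h1] using congrFun h 2⟩
  · refine ⟨![-v 1, v 0, 0], ![-v 2, 0, v 0], by simp; ring, by simp; ring, fun s t h => ?_⟩
    exact ⟨by simpa [h0] using congrFun h 1, by simpa [h0] using congrFun h 2⟩

lemma exists_aeval_smul_add_smul_eq {σ R A : Type*} [CommRing R] [CommRing A] [Algebra R A]
    {q : MvPolynomial σ R} (hq : q.IsHomogeneous 2) (u w : σ → A) :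
    ∃ a b c : A, ∀ s t : A,
      aeval (s • u + t • w) q = a * s ^ 2 + b * (s * t) + c * t ^ 2 := by
  have hmono : ∀ d ∈ q.support, ∃ a b c : A, ∀ s t : A,
      aeval (s • u + t • w) (monomial d (coeff d q)) = a * s ^ 2 + b * (s * t) + c * t ^ 2 := by
    intro d hd
    have hdeg : d.degree = 2 := by
      rw [Finsupp.degree_eq_weight_one]
      exact hq (mem_support_iff.1 hd)
    generalize coeff d q = r
    obtain ⟨i, j, rfl⟩ : ∃ i j, d = Finsupp.single i 1 + Finsupp.single j 1 := by
      obtain ⟨i, j, hij⟩ := Multiset.card_eq_two.1 ((Finsupp.card_toMultiset d).trans hdeg)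
      classical
      refine ⟨i, j, (AddEquiv.injective Multiset.toFinsupp.symm) ?_⟩
      simpa using hij
    refine ⟨algebraMap R A r * (u i * u j),
      algebraMap R A r * (u i * w j + w i * u j),
      algebraMap R A r * (w i * w j), fun s t => ?_⟩
    rw [monomial_add_single, ← C_mul_X_pow_eq_monomial]
    simp
    ring
  choose! a b c h using hmono
  refine ⟨∑ d ∈ q.support, a d, ∑ d ∈ q.support, b d, ∑ d ∈ q.support, c d, fun s t => ?_⟩
  conv_lhs => rw [q.as_sum]
  rw [map_sum, Finset.sum_mul, Finset.sum_mul, Finset.sum_mul, ← Finset.sum_add_distrib,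
    ← Finset.sum_add_distrib]
  exact Finset.sum_congr rfl fun d hd => h d hd s t

lemma exists_binary_quadratic_zero (a b c : ℂ) :
    ∃ s t : ℂ, (s ≠ 0 ∨ t ≠ 0) ∧ a * s ^ 2 + b * (s * t) + c * t ^ 2 = 0 := by
  by_cases ha : a = 0
  · exact ⟨1, 0, by simp, by simp [ha]⟩
  · obtain ⟨s, hs⟩ := exists_quadratic_eq_zero (b := b) (c := c) ha
      (IsAlgClosed.exists_eq_mul_self _)
    exact ⟨s, 1, by simp, by linear_combination hs⟩

/-- If two independent linear combinations of three numbers vanish, one of these numbers controls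
the vanishing of all of them. -/
lemma exists_forall_eq_zero_of_independent_relations {α β : Fin 3 → ℝ}
    (h : ∀ s t : ℝ, s • α + t • β = 0 → s = 0 ∧ t = 0) :
    ∃ k, ∀ Q : Fin 3 → ℂ, ∑ t, (α t : ℂ) * Q t = 0 → ∑ t, (β t : ℂ) * Q t = 0 → Q k = 0 →
      ∀ t, Q t = 0 := by
  have hli : LinearIndependent ℝ ![α, β] := LinearIndependent.pair_iff.2 h
  obtain ⟨k, hk⟩ := Function.ne_iff.1 (crossProduct_ne_zero_iff_linearIndependent.2 hli)
  refine ⟨k, fun Q h1 h2 hQ => ?_⟩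
  rw [Fin.sum_univ_three] at h1 h2
  rw [cross_apply] at hk
  have main : ∀ t, ((![α 1 * β 2 - α 2 * β 1, α 2 * β 0 - α 0 * β 2,
      α 0 * β 1 - α 1 * β 0] k : ℝ) : ℂ) * Q t = 0 := by
    intro t
    fin_cases k <;> simp only [Fin.zero_eta, Fin.mk_one, Fin.reduceFinMk, Fin.isValue,
      Matrix.cons_val] at hQ ⊢ <;> rw [hQ] at h1 h2 <;> push_cast <;> fin_cases t <;>
      simp only [Fin.zero_eta, Fin.mk_one, Fin.reduceFinMk, Fin.isValue, hQ, mul_zero] <;>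
      first
      | linear_combination (β 0 : ℂ) * h1 - (α 0 : ℂ) * h2
      | linear_combination (β 1 : ℂ) * h1 - (α 1 : ℂ) * h2
      | linear_combination (β 2 : ℂ) * h1 - (α 2 : ℂ) * h2
      | linear_combination (α 0 : ℂ) * h2 - (β 0 : ℂ) * h1
      | linear_combination (α 1 : ℂ) * h2 - (β 1 : ℂ) * h1
      | linear_combination (α 2 : ℂ) * h2 - (β 2 : ℂ) * h1
  exact fun t => (mul_eq_zero.1 (main t)).resolve_left (by exact_mod_cast hk)

lemma exists_orthogonal_of_not_linearIndependent {v : Fin 3 → Fin 3 → ℝ}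
    (h : ¬ LinearIndependent ℝ fun i => linearForm (v i)) :
    ∃ m : Fin 3 → ℝ, m ≠ 0 ∧ ∀ i, m 0 * v i 0 + m 1 * v i 1 + m 2 * v i 2 = 0 := by
  obtain ⟨g, hg, i, hi⟩ := Fintype.not_linearIndependent_iff.1 h
  have hz : Matrix.vecMul g (Matrix.of v) = 0 := by
    apply linearForm_eq_zero
    rw [← hg]
    simp [linearForm, lin, Matrix.vecMul, dotProduct, Fin.sum_univ_three, smul_eq_C_mul]
    ring
  have hdet : (Matrix.of v).det = 0 :=
    Matrix.exists_vecMul_eq_zero_iff.1 ⟨g, fun h0 => hi (by simp [h0]), hz⟩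
  obtain ⟨m, hm, hm'⟩ := Matrix.exists_mulVec_eq_zero_iff.2 hdet
  refine ⟨m, hm, fun i => ?_⟩
  have := congrFun hm' i
  simp [Matrix.mulVec, dotProduct, Fin.sum_univ_three] at this
  linear_combination this

/-- An ideal generated by three real quadrics that contains two independent multiples of a
linear form has a nontrivial complex zero. -/
lemma exists_common_zero {q : Fin 3 → MvPolynomial (Fin 3) ℝ} (hq : ∀ t, (q t).IsHomogeneous 2)
    {m u w : Fin 3 → ℝ} (hm : m ≠ 0) (huw : ∀ s t : ℝ, s • u + t • w = 0 → s = 0 ∧ t = 0)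
    (hu : linearForm m * linearForm u ∈ Ideal.span (Set.range q))
    (hw : linearForm m * linearForm w ∈ Ideal.span (Set.range q)) :
    ∃ P : Fin 3 → ℂ, P ≠ 0 ∧ ∀ p ∈ Ideal.span (Set.range q), aeval P p = 0 := by
  have hhom := fun v => (linearForm_isHomogeneous m).mul (linearForm_isHomogeneous v)
  obtain ⟨α, hα⟩ := exists_eq_sum_C_mul_of_mem_span hq (hhom u) hu
  obtain ⟨β, hβ⟩ := exists_eq_sum_C_mul_of_mem_span hq (hhom w) hw
  have hαβ : ∀ s t : ℝ, s • α + t • β = 0 → s = 0 ∧ t = 0 := by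
    intro s t hst
    refine huw s t (linearForm_eq_zero ?_)
    refine (mul_eq_zero.1 ?_).resolve_left fun h => hm (linearForm_eq_zero h)
    have hst' : ∀ i, C s * C (α i) + C t * C (β i) = (0 : MvPolynomial (Fin 3) ℝ) := by
      intro i
      simpa using congrArg (C (σ := Fin 3)) (congrFun hst i)
    calc linearForm m * linearForm (s • u + t • w)
        = C s * (linearForm m * linearForm u) + C t * (linearForm m * linearForm w) := by
          rw [linearForm_smul_add_smul]; ring
      _ = ∑ i, (C s * C (α i) + C t * C (β i)) * q i := by
          rw [hα, hβ, Finset.mul_sum, Finset.mul_sum, ← Finset.sum_add_distrib]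
          exact Finset.sum_congr rfl fun i _ => by ring
      _ = 0 := by simp [hst']
  obtain ⟨k, hk⟩ := exists_forall_eq_zero_of_independent_relations hαβ
  obtain ⟨x, y, hx, hy, hxy⟩ := exists_independent_orthogonal fun i => (m i : ℂ)
  obtain ⟨a, b, c, habc⟩ := exists_aeval_smul_add_smul_eq (hq k) x y
  obtain ⟨s, t, hst, hzero⟩ := exists_binary_quadratic_zero a b c
  have hmP : aeval (s • x + t • y) (linearForm m) = 0 := by
    rw [aeval_linearForm]
    simp
    linear_combination s * hx + t * hy
  refine ⟨s • x + t • y, fun h => ?_, fun p hp => ?_⟩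
  · obtain ⟨rfl, rfl⟩ := hxy s t h
    simp at hst
  · have hall := hk (fun i => aeval (s • x + t • y) (q i))
      (by simpa [hmP] using (congrArg (aeval (s • x + t • y)) hα).symm)
      (by simpa [hmP] using (congrArg (aeval (s • x + t • y)) hβ).symm)
      ((habc s t).trans hzero)
    have hle : Ideal.span (Set.range q) ≤ RingHom.ker (aeval (R := ℝ) (s • x + t • y)) := by
      rw [Ideal.span_le]
      rintro _ ⟨i, rfl⟩
      exact hall i
    exact hle hp

/-- Let `f = ℓ₁³ + ℓ₂³ + ℓ₃³ + ℓ₄³` be a sum of cubes of four real linear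
forms, and suppose the apolar ideal `f^⊥ = {p | p(∂)f = 0}` is generated, as an ideal of
`ℝ[x,y,z]`, by three homogeneous quadrics. Then any three of the linear forms
`ℓ₁, ℓ₂, ℓ₃, ℓ₄` are linearly independent. -/
theorem statement8 (a b c : Fin 4 → ℝ) (f : MvPolynomial (Fin 3) ℝ)
    (hf : f = ∑ i, lin (a i) (b i) (c i) ^ 3)
    (q : Fin 3 → MvPolynomial (Fin 3) ℝ)
    (hq : ∀ t, (q t).IsHomogeneous 2)
    (hgen : {p : MvPolynomial (Fin 3) ℝ | diffOp p f = 0} =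
      ↑(Ideal.span (Set.range q))) :
    ∀ i j k : Fin 4, i ≠ j → i ≠ k → j ≠ k →
      LinearIndependent ℝ
        ![lin (a i) (b i) (c i), lin (a j) (b j) (c j), lin (a k) (b k) (c k)] := by
  intro i j k hij hik hjk
  by_contra hdep
  let v : Fin 4 → Fin 3 → ℝ := fun i => ![a i, b i, c i]
  have hf' : f = ∑ i, linearForm (v i) ^ 3 := hf
  have hmem : ∀ (p : MvPolynomial (Fin 3) ℝ) (d : ℕ), p.IsHomogeneous d →
      (∀ i, (Nat.descFactorial 3 d : ℝ) * aeval (v i) p = 0) →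
      p ∈ Ideal.span (Set.range q) := by
    intro p d hp h
    rw [← SetLike.mem_coe, ← hgen, Set.mem_ofPred_eq, hf', diffOp_sum_linearForm_pow hp]
    exact Finset.sum_eq_zero fun i _ => by rw [h i, C_0, zero_mul]
  obtain ⟨l, hl⟩ : ∃ l : Fin 4, ∀ n, i = n ∨ j = n ∨ k = n ∨ l = n := by
    clear hdep
    revert i j k
    decide
  obtain ⟨m, hm, hmv⟩ := exists_orthogonal_of_not_linearIndependent (v := ![v i, v j, v k]) (by
    have hrows : (fun n => linearForm (![v i, v j, v k] n)) =
        ![lin (a i) (b i) (c i), lin (a j) (b j) (c j), lin (a k) (b k) (c k)] := by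
      funext n
      fin_cases n <;> rfl
    rwa [hrows])
  obtain ⟨u, w, hu, hw, huw⟩ := exists_independent_orthogonal (v l)
  have hprod : ∀ n : Fin 3 → ℝ, v l 0 * n 0 + v l 1 * n 1 + v l 2 * n 2 = 0 →
      linearForm m * linearForm n ∈ Ideal.span (Set.range q) := by
    intro n hn
    refine hmem _ 2 ((linearForm_isHomogeneous m).mul (linearForm_isHomogeneous n)) fun r => ?_
    rw [map_mul, aeval_linearForm, aeval_linearForm]
    simp only [Algebra.algebraMap_self, RingHom.id_apply]
    rcases hl r with rfl | rfl | rfl | rfl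
    · rw [show m 0 * v i 0 + m 1 * v i 1 + m 2 * v i 2 = 0 from hmv 0]; simp
    · rw [show m 0 * v j 0 + m 1 * v j 1 + m 2 * v j 2 = 0 from hmv 1]; simp
    · rw [show m 0 * v k 0 + m 1 * v k 1 + m 2 * v k 2 = 0 from hmv 2]; simp
    · rw [show n 0 * v l 0 + n 1 * v l 1 + n 2 * v l 2 = 0 by linear_combination hn]; simp
  obtain ⟨P, hP, hPz⟩ := exists_common_zero hq hm huw (hprod u hu) (hprod w hw)
  refine hP (funext fun n => ?_)
  have := hPz (X n ^ 4) (hmem _ 4 (by simpa using (isHomogeneous_X ℝ n).pow 4)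
    (by simp [Nat.descFactorial]))
  simpa using this
end

section
/- The real rank of the ternary quartic f = xyz(x+y+z) equals 7: f admits a real Waring decomposition of length 7, and it admits no real Waring decomposition of length at most 6. -/
open MvPolynomial

/-- The exponents of the quadratic monomials `x², y², z², yz, xz, xy`. -/
def quadricExponent : Fin 6 → Fin 3 → ℕ :=
  ![![2, 0, 0], ![0, 2, 0], ![0, 0, 2], ![0, 1, 1], ![1, 0, 1], ![1, 1, 0]]

/-- The quadratic Veronese vector of `(a, b, c)`. -/
def veronese (a b c : ℝ) (j : Fin 6) : ℝ :=
  a ^ quadricExponent j 0 * b ^ quadricExponent j 1 * c ^ quadricExponent j 2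

/-- The moment of the monomial `x ^ p * y ^ q * z ^ s` for the weights `lam` at the points
`(a i, b i, c i)`. -/
def moment {r : ℕ} (lam a b c : Fin r → ℝ) (p q s : ℕ) : ℝ :=
  ∑ i, lam i * (a i ^ p * b i ^ q * c i ^ s)

/-- Half the middle catalecticant of `xyz(x+y+z)`, with the quadrics ordered
as in `veronese`. -/
def catalecticant : Matrix (Fin 6) (Fin 6) ℝ :=
  !![0, 0, 0, 1, 0, 0;
     0, 0, 0, 0, 1, 0;
     0, 0, 0, 0, 0, 1;
     1, 0, 0, 0, 1, 1;
     0, 1, 0, 1, 0, 1;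
     0, 0, 1, 1, 1, 0]

/-- The inverse of `catalecticant`. -/
def catalecticantInv : Matrix (Fin 6) (Fin 6) ℝ :=
  !![0, -1, -1, 1, 0, 0;
     -1, 0, -1, 0, 1, 0;
     -1, -1, 0, 0, 0, 1;
     1, 0, 0, 0, 0, 0;
     0, 1, 0, 0, 0, 0;
     0, 0, 1, 0, 0, 0]

lemma catalecticant_mul_inv : catalecticant * catalecticantInv = 1 := by
  ext i j
  fin_cases i <;> fin_cases j <;>
    simp [catalecticant, catalecticantInv, Matrix.mul_apply, Fin.sum_univ_succ]

/-- The quadratic form of `catalecticantInv` is nonpositive on Veronese vectors. -/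
lemma veronese_dotProduct_catalecticantInv_nonpos (a b c : ℝ) :
    veronese a b c ⬝ᵥ (catalecticantInv.mulVec (veronese a b c)) ≤ 0 := by
  simp [veronese, quadricExponent, catalecticantInv, Matrix.mulVec, dotProduct, Fin.sum_univ_succ]
  nlinarith [sq_nonneg (a * b - a * c), sq_nonneg (a * b - b * c), sq_nonneg (a * c - b * c)]

/-- A quartic in power-sum form expands into its moments. -/
lemma sum_mul_linear_pow_four {r : ℕ} (lam a b c : Fin r → ℝ) (x y z : ℝ) :
    ∑ i, lam i * (a i * x + b i * y + c i * z) ^ 4 =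
      z ^ 4 * moment lam a b c 0 0 4 +
      4 * y * z ^ 3 * moment lam a b c 0 1 3 +
      6 * y ^ 2 * z ^ 2 * moment lam a b c 0 2 2 +
      4 * y ^ 3 * z * moment lam a b c 0 3 1 +
      y ^ 4 * moment lam a b c 0 4 0 +
      4 * x * z ^ 3 * moment lam a b c 1 0 3 +
      12 * x * y * z ^ 2 * moment lam a b c 1 1 2 +
      12 * x * y ^ 2 * z * moment lam a b c 1 2 1 +
      4 * x * y ^ 3 * moment lam a b c 1 3 0 +
      6 * x ^ 2 * z ^ 2 * moment lam a b c 2 0 2 +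
      12 * x ^ 2 * y * z * moment lam a b c 2 1 1 +
      6 * x ^ 2 * y ^ 2 * moment lam a b c 2 2 0 +
      4 * x ^ 3 * z * moment lam a b c 3 0 1 +
      4 * x ^ 3 * y * moment lam a b c 3 1 0 +
      x ^ 4 * moment lam a b c 4 0 0 := by
  simp only [moment, Finset.mul_sum, ← Finset.sum_add_distrib]
  exact Finset.sum_congr rfl fun i _ => by ring

/-- The moment matrix of a Waring decomposition of `xyz(x+y+z)` is its catalecticant. -/
lemma moment_matrix_eq_catalecticant {r : ℕ} (lam a b c : Fin r → ℝ)
    (h : ∀ x y z : ℝ, x * y * z * (x + y + z) =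
      ∑ i, lam i * (a i * x + b i * y + c i * z) ^ 4) :
    (Matrix.of fun i => veronese (a i) (b i) (c i)).transpose *
      Matrix.diagonal (fun i => 12 * lam i) *
      (Matrix.of fun i => veronese (a i) (b i) (c i)) = catalecticant := by
  simp only [sum_mul_linear_pow_four] at h
  have h004 := h 0 0 4
  have h013 := h 0 1 3
  have h022 := h 0 2 2
  have h031 := h 0 3 1
  have h040 := h 0 4 0
  have h103 := h 1 0 3
  have h112 := h 1 1 2
  have h121 := h 1 2 1
  have h130 := h 1 3 0
  have h202 := h 2 0 2
  have h211 := h 2 1 1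
  have h220 := h 2 2 0
  have h301 := h 3 0 1
  have h310 := h 3 1 0
  have h400 := h 4 0 0
  norm_num at h004 h013 h022 h031 h040 h103 h112 h121 h130 h202 h211 h220 h301 h310 h400
  have m004 : moment lam a b c 0 0 4 = 0 := by
    linarith
  have m013 : moment lam a b c 0 1 3 = 0 := by
    linarith
  have m022 : moment lam a b c 0 2 2 = 0 := by
    linarith
  have m031 : moment lam a b c 0 3 1 = 0 := by
    linarith
  have m040 : moment lam a b c 0 4 0 = 0 := by
    linarith
  have m103 : moment lam a b c 1 0 3 = 0 := by
    linarith
  have m112 : moment lam a b c 1 1 2 = 1 / 12 := by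
    linarith
  have m121 : moment lam a b c 1 2 1 = 1 / 12 := by
    linarith
  have m130 : moment lam a b c 1 3 0 = 0 := by
    linarith
  have m202 : moment lam a b c 2 0 2 = 0 := by
    linarith
  have m211 : moment lam a b c 2 1 1 = 1 / 12 := by
    linarith
  have m220 : moment lam a b c 2 2 0 = 0 := by
    linarith
  have m301 : moment lam a b c 3 0 1 = 0 := by
    linarith
  have m310 : moment lam a b c 3 1 0 = 0 := by
    linarith
  have m400 : moment lam a b c 4 0 0 = 0 := by
    linarith
  ext i j
  rw [Matrix.mul_apply]
  have hmoment : ∑ k, ((Matrix.of fun i => veronese (a i) (b i) (c i)).transpose *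
      Matrix.diagonal (fun i => 12 * lam i)) i k * veronese (a k) (b k) (c k) j =
      12 * moment lam a b c (quadricExponent i 0 + quadricExponent j 0)
        (quadricExponent i 1 + quadricExponent j 1)
        (quadricExponent i 2 + quadricExponent j 2) := by
    simp only [Matrix.mul_diagonal, Matrix.transpose_apply, Matrix.of_apply, moment, veronese,
      Finset.mul_sum]
    exact Finset.sum_congr rfl fun k _ => by ring
  refine hmoment.trans ?_
  fin_cases i <;> fin_cases j <;>
    simp [quadricExponent, catalecticant, m004, m013, m022, m031, m040, m103, m112, m121, m130,
      m202, m211, m220, m301, m310, m400]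

/-- The real rank of the ternary quartic `f = xyz(x+y+z)` equals 7: it has a
real Waring decomposition of length 7, and no real Waring decomposition of length less
than 7. -/
theorem statement10 :
    (∃ lam a b c : Fin 7 → ℝ,
        (X 0 * X 1 * X 2 * (X 0 + X 1 + X 2) : MvPolynomial (Fin 3) ℝ) =
          ∑ i, lam i • lin (a i) (b i) (c i) ^ 4)
      ∧ ∀ (r : ℕ) (lam a b c : Fin r → ℝ),
          (X 0 * X 1 * X 2 * (X 0 + X 1 + X 2) : MvPolynomial (Fin 3) ℝ) =
            ∑ i, lam i • lin (a i) (b i) (c i) ^ 4 → 7 ≤ r := by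
  refine ⟨⟨![1/12, 1/12, 1/12, 1/12, -1/12, -1/12, -1/12], ![1, 0, 0, 1, 1, 1, 0],
    ![0, 1, 0, 1, 1, 0, 1], ![0, 0, 1, 1, 0, 1, 1], ?_⟩, fun r lam a b c h => ?_⟩
  · refine MvPolynomial.funext fun v => ?_
    simp [Fin.sum_univ_succ, lin, smul_eval]
    ring
  · have hev (x y z : ℝ) : x * y * z * (x + y + z) =
        ∑ i, lam i * (a i * x + b i * y + c i * z) ^ 4 := by
      simpa [lin, smul_eval] using congrArg (eval ![x, y, z]) h
    have hB := moment_matrix_eq_catalecticant lam a b c hev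
    set V : Matrix (Fin r) (Fin 6) ℝ := Matrix.of fun i => veronese (a i) (b i) (c i) with hV
    set D : Matrix (Fin r) (Fin r) ℝ := Matrix.diagonal (fun i => 12 * lam i) with hD
    have hone : (V.transpose * D) * (V * catalecticantInv) = 1 := by
      rw [← Matrix.mul_assoc, hB, catalecticant_mul_inv]
    by_contra! hr
    have hr6 : 6 ≤ r := by
      have h1 := Matrix.rank_mul_le_left (V.transpose * D) (V * catalecticantInv)
      rw [hone, Matrix.rank_one] at h1
      simpa using h1.trans (Matrix.rank_le_card_width _)
    obtain rfl : r = 6 := by omega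
    have hinv : (V * catalecticantInv * V.transpose) * D = 1 := by
      rw [Matrix.mul_assoc]
      exact mul_eq_one_comm.mp hone
    have hlam (i : Fin 6) : lam i ≤ 0 := by
      have h1 := congrFun (congrFun hinv i) i
      rw [hD, Matrix.mul_diagonal, Matrix.one_apply_eq, Matrix.mul_assoc] at h1
      have h2 : (V * (catalecticantInv * V.transpose)) i i ≤ 0 :=
        veronese_dotProduct_catalecticantInv_nonpos (a i) (b i) (c i)
      nlinarith
    have hentry (j k : Fin 6) : ∑ i, V i j * (12 * lam i) * V i k = catalecticant j k := by
      rw [← hB, Matrix.mul_apply]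
      simp [hD, Matrix.mul_diagonal]
    have hsum : ∑ i, 12 * lam i * (V i 0 + V i 3) ^ 2 = 2 := by
      have h1 : ∑ i, 12 * lam i * (V i 0 + V i 3) ^ 2 = catalecticant 0 0 +
          2 * catalecticant 0 3 + catalecticant 3 3 := by
        simp only [← hentry, Finset.mul_sum, ← Finset.sum_add_distrib]
        exact Finset.sum_congr rfl fun i _ => by ring
      rw [h1]
      simp [catalecticant]
    have hneg : ∑ i, 12 * lam i * (V i 0 + V i 3) ^ 2 ≤ 0 :=
      Finset.sum_nonpos fun i _ =>
        mul_nonpos_of_nonpos_of_nonneg (by linarith [hlam i]) (sq_nonneg _)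
    linarith
end

section
/- The following identity holds in ℝ[x,y,z]: 360·x²y²z² = 4(x⁶ + y⁶ + z⁶) + (x+y+z)⁶ + (x+y−z)⁶ + (x−y+z)⁶ + (x−y−z)⁶ − 2[(x+y)⁶ + (x−y)⁶ + (x+z)⁶ + (x−z)⁶ + (y+z)⁶ + (y−z)⁶]. In particular, the sextic x²y²z² has real rank at most 13. -/
open MvPolynomial

/-- The degree-six identity behind the decomposition, in an arbitrary commutative ring. -/
theorem mul_sq_sq_sq_eq_sum_sixth_powers {R : Type*} [CommRing R] (x y z : R) :
    360 * (x ^ 2 * y ^ 2 * z ^ 2) =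
      4 * (x ^ 6 + y ^ 6 + z ^ 6)
        + (x + y + z) ^ 6 + (x + y - z) ^ 6 + (x - y + z) ^ 6 + (x - y - z) ^ 6
        - 2 * ((x + y) ^ 6 + (x - y) ^ 6 + (x + z) ^ 6 + (x - z) ^ 6
            + (y + z) ^ 6 + (y - z) ^ 6) := by
  ring

/-- In `ℝ[x,y,z]` one has
`360·x²y²z² = 4(x⁶+y⁶+z⁶) + (x+y+z)⁶ + (x+y−z)⁶ + (x−y+z)⁶ + (x−y−z)⁶
− 2[(x+y)⁶+(x−y)⁶+(x+z)⁶+(x−z)⁶+(y+z)⁶+(y−z)⁶]`; in particular the sextic `x²y²z²`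
has real rank at most 13. -/
theorem statement12 :
    (C 360 * (X 0 ^ 2 * X 1 ^ 2 * X 2 ^ 2) : MvPolynomial (Fin 3) ℝ) =
        C 4 * (X 0 ^ 6 + X 1 ^ 6 + X 2 ^ 6)
          + (X 0 + X 1 + X 2) ^ 6 + (X 0 + X 1 - X 2) ^ 6
          + (X 0 - X 1 + X 2) ^ 6 + (X 0 - X 1 - X 2) ^ 6
          - C 2 * ((X 0 + X 1) ^ 6 + (X 0 - X 1) ^ 6 + (X 0 + X 2) ^ 6 + (X 0 - X 2) ^ 6
              + (X 1 + X 2) ^ 6 + (X 1 - X 2) ^ 6)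
      ∧ ∃ lam a b c : Fin 13 → ℝ,
          (X 0 ^ 2 * X 1 ^ 2 * X 2 ^ 2 : MvPolynomial (Fin 3) ℝ) =
            ∑ i, lam i • lin (a i) (b i) (c i) ^ 6 := by
  rw [show (C 360 : MvPolynomial (Fin 3) ℝ) = 360 from map_ofNat C 360,
    show (C 4 : MvPolynomial (Fin 3) ℝ) = 4 from map_ofNat C 4,
    show (C 2 : MvPolynomial (Fin 3) ℝ) = 2 from map_ofNat C 2]
  have key := mul_sq_sq_sq_eq_sum_sixth_powers (R := MvPolynomial (Fin 3) ℝ) (X 0) (X 1) (X 2)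
  refine ⟨key,
    ![4 * 360⁻¹, 4 * 360⁻¹, 4 * 360⁻¹, 360⁻¹, 360⁻¹, 360⁻¹, 360⁻¹,
      -2 * 360⁻¹, -2 * 360⁻¹, -2 * 360⁻¹, -2 * 360⁻¹, -2 * 360⁻¹, -2 * 360⁻¹],
    ![1, 0, 0, 1, 1, 1, 1, 1, 1, 1, 1, 0, 0],
    ![0, 1, 0, 1, 1, -1, -1, 1, -1, 0, 0, 1, 1],
    ![0, 0, 1, 1, -1, 1, -1, 0, 0, 1, -1, 1, -1], ?_⟩
  have hinv : (C 360⁻¹ * 360 : MvPolynomial (Fin 3) ℝ) = 1 := by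
    rw [← map_ofNat C 360, ← C_mul]
    norm_num
  simp only [Fin.sum_univ_succ, lin]
  simp [smul_eq_C_mul, map_ofNat]
  linear_combination C 360⁻¹ * key - X 0 ^ 2 * X 1 ^ 2 * X 2 ^ 2 * hinv
end

section
/- The sextic x²y²z² has no real Waring decomposition of length at most 10; that is, there do not exist real numbers λ_1, …, λ_{10} and real numbers a_i, b_i, c_i with x²y²z² = ∑_{i=1}^{10} λ_i (a_i x + b_i y + c_i z)⁶. Hence rrk(x²y²z²) ≥ 11. -/
open MvPolynomial

lemma pderiv_lin_pow (a b c : ℝ) (k : Fin 3) (n : ℕ) :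
    pderiv k (lin a b c ^ n) = ((n : ℝ) * ![a, b, c] k) • lin a b c ^ (n - 1) := by
  have h : pderiv k (lin a b c) = C (![a, b, c] k) := by
    fin_cases k <;> simp [lin, pderiv_X]
  rw [pderiv_pow, h, smul_eq_C_mul, C_mul, map_natCast]
  ring

lemma iterate_pderiv_lin_pow (a b c : ℝ) (k : Fin 3) (m n : ℕ) :
    (⇑(pderiv k))^[m] (lin a b c ^ n) =
      ((n.descFactorial m : ℝ) * ![a, b, c] k ^ m) • lin a b c ^ (n - m) := by
  induction m with
  | zero => simp
  | succ m ih =>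
    rw [Function.iterate_succ_apply', ih, Derivation.map_smul, pderiv_lin_pow, smul_smul,
      Nat.sub_sub, Nat.descFactorial_succ, Nat.cast_mul]
    congr 1
    ring

lemma iterate_pderiv_smul (k : Fin 3) (m : ℕ) (s : ℝ) (f : MvPolynomial (Fin 3) ℝ) :
    (⇑(pderiv k))^[m] (s • f) = s • (⇑(pderiv k))^[m] f := by
  induction m with
  | zero => rfl
  | succ m ih => rw [Function.iterate_succ_apply', ih, Derivation.map_smul,
      Function.iterate_succ_apply']

lemma iterate_pderiv_sum {ι : Type*} (t : Finset ι) (k : Fin 3) (m : ℕ)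
    (f : ι → MvPolynomial (Fin 3) ℝ) :
    (⇑(pderiv k))^[m] (∑ i ∈ t, f i) = ∑ i ∈ t, (⇑(pderiv k))^[m] (f i) := by
  induction m with
  | zero => rfl
  | succ m ih => simp only [Function.iterate_succ_apply', ih, map_sum]

lemma descFactorial_mul_eq {p q s : ℕ} (hs : p + q + s = 6) :
    Nat.descFactorial 6 s * Nat.descFactorial (6 - s) q * Nat.descFactorial (6 - s - q) p =
      720 := by
  rw [show 6 - s - q = p by omega, Nat.descFactorial_self, mul_assoc, ← mul_comm p.factorial,
    show 720 = Nat.factorial 6 from rfl, ← Nat.factorial_mul_descFactorial (show s ≤ 6 by omega),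
    ← Nat.factorial_mul_descFactorial (show q ≤ 6 - s by omega), show 6 - s - q = p by omega]
  ring

lemma iterate_pderiv_monomial (k : Fin 3) (m : ℕ) (d : Fin 3 →₀ ℕ) (v : ℝ) :
    (⇑(pderiv k))^[m] (monomial d v) =
      monomial (d - Finsupp.single k m) (v * (d k).descFactorial m) := by
  induction m with
  | zero => simp
  | succ m ih =>
    rw [Function.iterate_succ_apply', ih, pderiv_monomial, Nat.descFactorial_succ, tsub_tsub,
      ← Finsupp.single_add, Nat.cast_mul]
    congr 1
    simp
    ring

lemma constantCoeff_iterate_pderiv_sextic {p q s : ℕ} (hs : p + q + s = 6) :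
    constantCoeff ((⇑(pderiv (0 : Fin 3)))^[p] ((⇑(pderiv (1 : Fin 3)))^[q]
      ((⇑(pderiv (2 : Fin 3)))^[s] (X 0 ^ 2 * X 1 ^ 2 * X 2 ^ 2 : MvPolynomial (Fin 3) ℝ)))) =
      if p = 2 ∧ q = 2 ∧ s = 2 then (8 : ℝ) else 0 := by
  have hX : (X 0 ^ 2 * X 1 ^ 2 * X 2 ^ 2 : MvPolynomial (Fin 3) ℝ) =
      monomial (Finsupp.single 0 2 + Finsupp.single 1 2 + Finsupp.single 2 2) 1 := by
    simp [X_pow_eq_monomial, monomial_mul]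
  rw [hX, iterate_pderiv_monomial, iterate_pderiv_monomial, iterate_pderiv_monomial]
  split_ifs with h
  · obtain ⟨rfl, rfl, rfl⟩ := h
    have h0 : (Finsupp.single 0 2 + Finsupp.single 1 2 + Finsupp.single 2 2 -
        Finsupp.single 2 2 - Finsupp.single 1 2 - Finsupp.single 0 2 : Fin 3 →₀ ℕ) = 0 := by
      ext k
      fin_cases k <;> simp
    rw [h0]
    simp [Nat.descFactorial]
    norm_num
  · have hgt : 2 < p ∨ 2 < q ∨ 2 < s := by omega
    rcases hgt with hgt | hgt | hgt <;> simp [Nat.descFactorial_of_lt hgt]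

/-- The sixth order derivatives of a Waring decomposition of `x²y²z²` give its moments. -/
lemma moment_eq {r : ℕ} {lam a b c : Fin r → ℝ}
    (h : (X 0 ^ 2 * X 1 ^ 2 * X 2 ^ 2 : MvPolynomial (Fin 3) ℝ) =
      ∑ i, lam i • lin (a i) (b i) (c i) ^ 6) (p q s : ℕ) (hs : p + q + s = 6) :
    ∑ i, lam i * (a i ^ p * b i ^ q * c i ^ s) =
      if p = 2 ∧ q = 2 ∧ s = 2 then 1 / 90 else 0 := by
  have hD := congrArg (fun f => constantCoeff ((⇑(pderiv (0 : Fin 3)))^[p]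
    ((⇑(pderiv (1 : Fin 3)))^[q] ((⇑(pderiv (2 : Fin 3)))^[s] f)))) h
  have hR : constantCoeff ((⇑(pderiv (0 : Fin 3)))^[p] ((⇑(pderiv (1 : Fin 3)))^[q]
      ((⇑(pderiv (2 : Fin 3)))^[s] (∑ i, lam i • lin (a i) (b i) (c i) ^ 6)))) =
      720 * ∑ i, lam i * (a i ^ p * b i ^ q * c i ^ s) := by
    have hf : (Nat.descFactorial 6 s : ℝ) * (Nat.descFactorial (6 - s) q : ℝ) *
        (Nat.descFactorial (6 - s - q) p : ℝ) = 720 := mod_cast descFactorial_mul_eq hs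
    simp only [iterate_pderiv_sum, iterate_pderiv_smul, iterate_pderiv_lin_pow, smul_smul,
      map_sum, Finset.mul_sum]
    refine Finset.sum_congr rfl fun i _ => ?_
    rw [show 6 - s - q - p = 0 by omega, pow_zero, smul_eq_C_mul, mul_one, constantCoeff_C, ← hf]
    simp
    ring
  simp only [hR] at hD
  have hL := constantCoeff_iterate_pderiv_sextic hs
  rw [hL] at hD
  split_ifs at hD ⊢ <;> linarith

lemma exists_pow_three_eq (y : ℝ) : ∃ t : ℝ, t ^ 3 = y := by
  have key : ∀ u : ℝ, 0 ≤ u → ∃ t : ℝ, t ^ 3 = u := fun u hu =>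
    ⟨u ^ ((3 : ℕ) : ℝ)⁻¹, Real.rpow_inv_natCast_pow hu (by norm_num)⟩
  rcases le_total 0 y with hy | hy
  · exact key y hy
  · obtain ⟨t, ht⟩ := key (-y) (by linarith)
    exact ⟨-t, by linear_combination -ht⟩

/-- A weighted relation between cubes descends to a linear relation, by real cube roots. -/
lemma exists_mul_eq_of_cube_relation {ι : Type*} {w a b : ι → ℝ} {α β : ℝ} (hα : α ≠ 0)
    (h : ∀ i, w i * (α * a i ^ 3 + β * b i ^ 3) = 0) : ∃ t, ∀ i, w i * a i = w i * (t * b i) := by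
  obtain ⟨t, ht⟩ := exists_pow_three_eq (-β / α)
  refine ⟨t, fun i => ?_⟩
  rcases mul_eq_zero.1 (h i) with hw | hc
  · simp [hw]
  · have hodd : Odd 3 := by decide
    have hab : a i ^ 3 = (t * b i) ^ 3 := by
      rw [mul_pow, ht]
      field_simp
      linarith
    rw [hodd.pow_inj.1 hab]

/-- In a Waring decomposition of `x²y²z²`, no nontrivial combination of `x³` and `y³` vanishes at
all points of nonzero weight. -/
lemma eq_zero_of_cube_relation {r : ℕ} {lam a b c : Fin r → ℝ}
    (h : (X 0 ^ 2 * X 1 ^ 2 * X 2 ^ 2 : MvPolynomial (Fin 3) ℝ) =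
      ∑ i, lam i • lin (a i) (b i) (c i) ^ 6) {α β : ℝ}
    (hz : ∀ i, lam i * (α * a i ^ 3 + β * b i ^ 3) = 0) : α = 0 ∧ β = 0 := by
  have h222 := moment_eq h 2 2 2 rfl
  constructor
  · by_contra hα
    obtain ⟨t, ht⟩ := exists_mul_eq_of_cube_relation hα hz
    have h132 := moment_eq h 1 3 2 rfl
    have : ∑ i, lam i * (a i ^ 2 * b i ^ 2 * c i ^ 2) =
        t * ∑ i, lam i * (a i ^ 1 * b i ^ 3 * c i ^ 2) := by
      rw [Finset.mul_sum]
      refine Finset.sum_congr rfl fun i _ => ?_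
      linear_combination (a i * b i ^ 2 * c i ^ 2) * ht i
    rw [this, h132] at h222
    norm_num at h222
  · by_contra hβ
    obtain ⟨t, ht⟩ := exists_mul_eq_of_cube_relation (w := lam) (a := b) (b := a) (β := α) hβ
      fun i => by rw [add_comm]; exact hz i
    have h312 := moment_eq h 3 1 2 rfl
    have : ∑ i, lam i * (a i ^ 2 * b i ^ 2 * c i ^ 2) =
        t * ∑ i, lam i * (a i ^ 3 * b i ^ 1 * c i ^ 2) := by
      rw [Finset.mul_sum]
      refine Finset.sum_congr rfl fun i _ => ?_
      linear_combination (a i ^ 2 * b i * c i ^ 2) * ht i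
    rw [this, h312] at h222
    norm_num at h222

/-- The exponents of the cubic monomials other than `z³`. -/
def cubicExp : Fin 9 → Fin 3 → ℕ :=
  ![![3, 0, 0], ![0, 3, 0], ![2, 1, 0], ![2, 0, 1], ![1, 2, 0], ![0, 2, 1], ![1, 0, 2],
    ![0, 1, 2], ![1, 1, 1]]

lemma sum_cubicExp (k : Fin 9) : cubicExp k 0 + cubicExp k 1 + cubicExp k 2 = 3 := by
  revert k; decide

/-- The values of the cubic monomials other than `z³` at the points `(a i, b i, c i)`. -/
def cubicMatrix {r : ℕ} (a b c : Fin r → ℝ) : Matrix (Fin r) (Fin 9) ℝ :=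
  fun i k => a i ^ cubicExp k 0 * b i ^ cubicExp k 1 * c i ^ cubicExp k 2

lemma sum_mul_cubicMatrix {r : ℕ} {lam a b c : Fin r → ℝ}
    (h : (X 0 ^ 2 * X 1 ^ 2 * X 2 ^ 2 : MvPolynomial (Fin 3) ℝ) =
      ∑ i, lam i • lin (a i) (b i) (c i) ^ 6) (k l : Fin 9) :
    ∑ i, cubicMatrix a b c i k * (lam i * cubicMatrix a b c i l) =
      if cubicExp k 0 + cubicExp l 0 = 2 ∧ cubicExp k 1 + cubicExp l 1 = 2 ∧
        cubicExp k 2 + cubicExp l 2 = 2 then 1 / 90 else 0 := by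
  rw [← moment_eq h _ _ _ (by have := sum_cubicExp k; have := sum_cubicExp l; omega)]
  refine Finset.sum_congr rfl fun i _ => ?_
  simp only [cubicMatrix, pow_add]
  ring

/-- The values of these nine cubic monomials at the points of a decomposition are linearly
independent. -/
lemma cubicMatrix_mulVec_injective {r : ℕ} {lam a b c : Fin r → ℝ}
    (h : (X 0 ^ 2 * X 1 ^ 2 * X 2 ^ 2 : MvPolynomial (Fin 3) ℝ) =
      ∑ i, lam i • lin (a i) (b i) (c i) ^ 6) :
    Function.Injective (cubicMatrix a b c).mulVecLin := by
  rw [← LinearMap.ker_eq_bot, LinearMap.ker_eq_bot']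
  intro p hp
  have hp' : ∀ i, ∑ k, cubicMatrix a b c i k * p k = 0 := fun i => congrFun hp i
  have hpair : ∀ l : Fin 9, ∑ k, (if cubicExp k 0 + cubicExp l 0 = 2 ∧
      cubicExp k 1 + cubicExp l 1 = 2 ∧ cubicExp k 2 + cubicExp l 2 = 2 then
        (1 / 90 : ℝ) else 0) * p k = 0 := by
    intro l
    simp only [← sum_mul_cubicMatrix h, Finset.sum_mul]
    rw [Finset.sum_comm]
    refine Finset.sum_eq_zero fun i _ => ?_
    calc _ = (lam i * cubicMatrix a b c i l) * ∑ k, cubicMatrix a b c i k * p k := by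
            rw [Finset.mul_sum]; exact Finset.sum_congr rfl fun k _ => by ring
      _ = 0 := by rw [hp' i, mul_zero]
  have p2 : p 2 = 0 := by simpa [Fin.sum_univ_succ, cubicExp] using hpair 7
  have p3 : p 3 = 0 := by simpa [Fin.sum_univ_succ, cubicExp] using hpair 5
  have p4 : p 4 = 0 := by simpa [Fin.sum_univ_succ, cubicExp] using hpair 6
  have p5 : p 5 = 0 := by simpa [Fin.sum_univ_succ, cubicExp] using hpair 3
  have p6 : p 6 = 0 := by simpa [Fin.sum_univ_succ, cubicExp] using hpair 4
  have p7 : p 7 = 0 := by simpa [Fin.sum_univ_succ, cubicExp] using hpair 2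
  have p8 : p 8 = 0 := by simpa [Fin.sum_univ_succ, cubicExp] using hpair 8
  obtain ⟨p0, p1⟩ := eq_zero_of_cube_relation h (α := p 0) (β := p 1) fun i => by
    have := hp' i
    rw [Fin.sum_univ_castSucc, Fin.sum_univ_eight] at this
    simp [cubicMatrix, cubicExp, p2, p3, p4, p5, p6, p7, p8] at this
    rw [mul_eq_zero]
    right
    linarith
  funext k
  fin_cases k <;> assumption

/-- The sextic `x²y²z²` has no real Waring decomposition of length at most
10; hence `rrk(x²y²z²) ≥ 11`. -/
theorem statement13 :
    ∀ r : ℕ, r ≤ 10 →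
      ¬ ∃ lam a b c : Fin r → ℝ,
          (X 0 ^ 2 * X 1 ^ 2 * X 2 ^ 2 : MvPolynomial (Fin 3) ℝ) =
            ∑ i, lam i • lin (a i) (b i) (c i) ^ 6 := by
  rintro r hr ⟨lam, a, b, c, h⟩
  set M := cubicMatrix a b c with hM
  have hrank : M.rank = 9 := by
    rw [Matrix.rank, LinearMap.finrank_range_of_inj (cubicMatrix_mulVec_injective h)]
    simp
  have hker := LinearMap.finrank_range_add_finrank_ker M.transpose.mulVecLin
  rw [← Matrix.rank, Matrix.rank_transpose, hrank, Module.finrank_fin_fun] at hker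
  have hmem : ∀ l : Fin 2, (fun i => lam i * M i (Fin.castLE (by norm_num) l)) ∈
      LinearMap.ker M.transpose.mulVecLin := by
    intro l
    rw [LinearMap.mem_ker]
    funext k
    refine (sum_mul_cubicMatrix h k _).trans (if_neg ?_)
    revert k l
    decide
  have hli : LinearIndependent ℝ
      (fun l => (⟨_, hmem l⟩ : LinearMap.ker M.transpose.mulVecLin)) := by
    rw [Fintype.linearIndependent_iff]
    intro g hg
    have hz := eq_zero_of_cube_relation h (α := g 0) (β := g 1) fun i => by
      have := congrFun (congrArg Subtype.val hg) i
      simp [hM, cubicMatrix, cubicExp] at this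
      linarith
    simpa [Fin.forall_fin_two] using hz
  have := hli.fintype_card_le_finrank
  rw [Fintype.card_fin] at this
  omega
end

section
/- The complex Waring rank of x²y²z² equals 9: the smallest integer r such that there exist complex numbers a_i, b_i, c_i with x²y²z² = ∑_{i=1}^{r} (a_i x + b_i y + c_i z)⁶ in ℂ[x,y,z] is r = 9. -/
open MvPolynomial

/-- The complex linear form `a·x + b·y + c·z`. -/
noncomputable def linC (a b c : ℂ) : MvPolynomial (Fin 3) ℂ :=
  C a * X 0 + C b * X 1 + C c * X 2

theorem Polynomial.coeff_C_mul_X_add_C_pow {R : Type*} [CommSemiring R] (u v : R) (n k : ℕ) :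
    ((Polynomial.C u * Polynomial.X + Polynomial.C v) ^ n).coeff k =
      u ^ k * v ^ (n - k) * n.choose k := by
  have h : ∀ m ∈ Finset.range (n + 1),
      ((Polynomial.C u * Polynomial.X) ^ m * Polynomial.C v ^ (n - m) *
        ((n.choose m : ℕ) : Polynomial R)).coeff k =
      if k = m then u ^ m * v ^ (n - m) * n.choose m else 0 := by
    intro m _
    have : (Polynomial.C u * Polynomial.X) ^ m * Polynomial.C v ^ (n - m) *
        ((n.choose m : ℕ) : Polynomial R) =
        Polynomial.C (u ^ m * v ^ (n - m) * n.choose m) * Polynomial.X ^ m := by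
      simp only [map_mul, map_pow, map_natCast]
      ring
    rw [this, Polynomial.coeff_C_mul_X_pow]
  rw [add_pow, Polynomial.finsetSum_coeff, Finset.sum_congr rfl h, Finset.sum_ite_eq]
  split_ifs with hk
  · rfl
  · rw [Finset.mem_range, not_lt] at hk
    simp [Nat.choose_eq_zero_of_lt hk]

/-- Comparing coefficients in a Waring decomposition of `x²y²z²` gives its moments. -/
theorem sum_pow_eq_of_waring {r : ℕ} {a b c : Fin r → ℂ}
    (h : (X 0 ^ 2 * X 1 ^ 2 * X 2 ^ 2 : MvPolynomial (Fin 3) ℂ) =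
      ∑ i, linC (a i) (b i) (c i) ^ 6) (p q : ℕ) :
    (∑ i, a i ^ p * b i ^ q * c i ^ (6 - q - p)) * ((6 - q).choose p * (6 : ℕ).choose q) =
      if p = 2 ∧ q = 2 then 1 else 0 := by
  let φ : MvPolynomial (Fin 3) ℂ →ₐ[ℂ] Polynomial (Polynomial ℂ) :=
    aeval ![Polynomial.C Polynomial.X, Polynomial.X, 1]
  have hφ : ∀ u v w : ℂ, φ (linC u v w) =
      Polynomial.C (Polynomial.C v) * Polynomial.X +
        Polynomial.C (Polynomial.C u * Polynomial.X + Polynomial.C w) := by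
    intro u v w
    simp [φ, linC, ← algebraMap_eq, Polynomial.algebraMap_apply]
    ring
  have h' := congrArg (fun P => ((φ P).coeff q).coeff p) h
  simp only [map_sum, map_pow, hφ, Polynomial.finsetSum_coeff,
    Polynomial.coeff_C_mul_X_add_C_pow] at h'
  have hl : φ (X 0 ^ 2 * X 1 ^ 2 * X 2 ^ 2) =
      Polynomial.C (Polynomial.X ^ 2) * Polynomial.X ^ 2 := by
    simp [φ]
  rw [hl, Polynomial.coeff_C_mul_X_pow] at h'
  have hr : ∀ i, ((Polynomial.C (b i)) ^ q *
      (Polynomial.C (a i) * Polynomial.X + Polynomial.C (c i)) ^ (6 - q) *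
        (((6 : ℕ).choose q : ℕ) : Polynomial ℂ)).coeff p =
      a i ^ p * b i ^ q * c i ^ (6 - q - p) * ((6 - q).choose p * (6 : ℕ).choose q) := by
    intro i
    rw [← Polynomial.C_pow, ← map_natCast Polynomial.C, Polynomial.coeff_mul_C,
      Polynomial.coeff_C_mul, Polynomial.coeff_C_mul_X_add_C_pow]
    ring
  simp only [hr] at h'
  rw [Finset.sum_mul, ← h']
  by_cases hq : q = 2 <;> simp [hq, Polynomial.coeff_X_pow]

theorem nine_le_of_waring {r : ℕ} {a b c : Fin r → ℂ}
    (h : (X 0 ^ 2 * X 1 ^ 2 * X 2 ^ 2 : MvPolynomial (Fin 3) ℂ) =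
      ∑ i, linC (a i) (b i) (c i) ^ 6) : 9 ≤ r := by
  by_contra! hr
  let v : Fin 3 × Fin 3 → Fin r → ℂ := fun m n => (a n / c n) ^ (m.1 : ℕ) * (b n / c n) ^ (m.2 : ℕ)
  have hv : ¬ LinearIndependent ℂ v := by
    intro hli
    have := hli.fintype_card_le_finrank
    simp at this
    omega
  obtain ⟨g, hg, m₁, hm₁⟩ := Fintype.not_linearIndependent_iff.1 hv
  obtain ⟨m₀, hm₀, hmax⟩ := (Finset.univ.filter fun m => g m ≠ 0).exists_max_image
    (fun m => (m.1 : ℕ) + (m.2 : ℕ)) ⟨m₁, by simp [hm₁]⟩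
  simp only [Finset.mem_filter, Finset.mem_univ, true_and] at hm₀ hmax
  have hzero : ∑ m, g m * ∑ n, c n ^ 6 * (a n / c n) ^ (2 - m₀.1 : ℕ) *
      (b n / c n) ^ (2 - m₀.2 : ℕ) * v m n = 0 := by
    simp only [Finset.mul_sum]
    rw [Finset.sum_comm]
    refine Finset.sum_eq_zero fun n _ => ?_
    have hn : ∑ m, g m * v m n = 0 := by simpa using congrFun hg n
    rw [← mul_zero (c n ^ 6 * (a n / c n) ^ (2 - m₀.1 : ℕ) * (b n / c n) ^ (2 - m₀.2 : ℕ)), ← hn,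
      Finset.mul_sum]
    exact Finset.sum_congr rfl fun m _ => by ring
  have hmoment : ∀ m, g m ≠ 0 → ∑ n, c n ^ 6 * (a n / c n) ^ (2 - m₀.1 : ℕ) *
      (b n / c n) ^ (2 - m₀.2 : ℕ) * v m n =
      ∑ n, a n ^ (2 - m₀.1 + m.1 : ℕ) * b n ^ (2 - m₀.2 + m.2 : ℕ) *
        c n ^ (6 - (2 - m₀.2 + m.2) - (2 - m₀.1 + m.1) : ℕ) := by
    intro m hm
    have hle := hmax m hm
    refine Finset.sum_congr rfl fun n _ => ?_
    obtain ⟨s, hs⟩ : ∃ s : ℕ, 6 = (2 - m₀.1 + m.1 : ℕ) + (2 - m₀.2 + m.2 : ℕ) + (s + 1) :=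
      ⟨5 - (2 - m₀.1 + m.1) - (2 - m₀.2 + m.2), by omega⟩
    have hs' : (6 - (2 - m₀.2 + m.2) - (2 - m₀.1 + m.1) : ℕ) = s + 1 := by omega
    rw [hs']
    by_cases hc : c n = 0
    · simp [hc]
    · have h6 : c n ^ 6 = c n ^ (2 - m₀.1 + m.1 : ℕ) * c n ^ (2 - m₀.2 + m.2 : ℕ) *
          c n ^ (s + 1) := by rw [← pow_add, ← pow_add, ← hs]
      have ha : c n ^ (2 - m₀.1 + m.1 : ℕ) * (a n / c n) ^ (2 - m₀.1 + m.1 : ℕ) =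
          a n ^ (2 - m₀.1 + m.1 : ℕ) := by rw [← mul_pow, mul_div_cancel₀ _ hc]
      have hb : c n ^ (2 - m₀.2 + m.2 : ℕ) * (b n / c n) ^ (2 - m₀.2 + m.2 : ℕ) =
          b n ^ (2 - m₀.2 + m.2 : ℕ) := by rw [← mul_pow, mul_div_cancel₀ _ hc]
      rw [← ha, ← hb, h6]
      simp only [v, pow_add (a n / c n), pow_add (b n / c n)]
      ring
  rw [Finset.sum_eq_single m₀] at hzero
  · rw [hmoment m₀ hm₀] at hzero
    have h1 : (2 - m₀.1 + m₀.1 : ℕ) = 2 := by omega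
    have h2 : (2 - m₀.2 + m₀.2 : ℕ) = 2 := by omega
    have h22 := sum_pow_eq_of_waring h 2 2
    rw [h1, h2] at hzero
    rw [(mul_eq_zero.1 hzero).resolve_left hm₀] at h22
    simp at h22
  · intro m _ hne
    by_cases hm : g m = 0
    · simp [hm]
    have hle := hmax m hm
    rw [hmoment m hm]
    have hpq := sum_pow_eq_of_waring h (2 - m₀.1 + m.1) (2 - m₀.2 + m.2)
    rw [if_neg, mul_eq_zero] at hpq
    · refine mul_eq_zero_of_right _ (hpq.resolve_right ?_)
      have hp : ((6 - (2 - m₀.2 + m.2) : ℕ).choose (2 - m₀.1 + m.1)) ≠ 0 :=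
        (Nat.choose_pos (by omega)).ne'
      have hq : ((6 : ℕ).choose (2 - m₀.2 + m.2)) ≠ 0 := (Nat.choose_pos (by omega)).ne'
      exact mul_ne_zero (Nat.cast_ne_zero.2 hp) (Nat.cast_ne_zero.2 hq)
    · rintro ⟨h1, h2⟩
      exact hne (Prod.ext (Fin.ext (by omega)) (Fin.ext (by omega)))
  · simp

section CubeRoots

variable {R : Type*} [CommRing R] {w : R}

theorem cube_root_weighted_sum_pow_six (hw : w ^ 2 + w + 1 = 0) (A y : R) :
    (A + y) ^ 6 + w * (A + w * y) ^ 6 + w ^ 2 * (A + w ^ 2 * y) ^ 6 =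
      45 * A ^ 4 * y ^ 2 + 18 * A * y ^ 5 := by
  grind

theorem cube_root_weighted_sum_pow_four (hw : w ^ 2 + w + 1 = 0) (A y : R) :
    (A + y) ^ 4 + w * (A + w * y) ^ 4 + w ^ 2 * (A + w ^ 2 * y) ^ 4 = 18 * A ^ 2 * y ^ 2 := by
  grind

theorem cube_root_waring (hw : w ^ 2 + w + 1 = 0) (x y z : R) :
    ∑ i : Fin 3, ∑ j : Fin 3,
      w ^ (i + j : ℕ) * (x + w ^ (i : ℕ) * y + w ^ (j : ℕ) * z) ^ 6 =
      810 * (x ^ 2 * y ^ 2 * z ^ 2) := by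
  have h0 := cube_root_weighted_sum_pow_six hw (x + y) z
  have h1 := cube_root_weighted_sum_pow_six hw (x + w * y) z
  have h2 := cube_root_weighted_sum_pow_six hw (x + w ^ 2 * y) z
  have h4 := cube_root_weighted_sum_pow_four hw x y
  simp only [Fin.sum_univ_three, Fin.val_zero, Fin.val_one, Fin.val_two]
  linear_combination h0 + w * h1 + w ^ 2 * h2 + 45 * z ^ 2 * h4 +
    18 * z ^ 5 * (x + y * (w ^ 2 - w + 1)) * hw

end CubeRoots

theorem exists_waring_nine : ∃ a b c : Fin 9 → ℂ,
    (X 0 ^ 2 * X 1 ^ 2 * X 2 ^ 2 : MvPolynomial (Fin 3) ℂ) =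
      ∑ i, linC (a i) (b i) (c i) ^ 6 := by
  obtain ⟨w, hw⟩ : ∃ w : ℂ, w ^ 2 + w + 1 = 0 := by
    obtain ⟨s, hs⟩ := IsAlgClosed.exists_pow_nat_eq (-3 : ℂ) (n := 2) (by norm_num)
    exact ⟨(s - 1) / 2, by linear_combination hs / 4⟩
  have hroot : ∀ k : ℕ, ∃ l : ℂ, l ^ 6 = w ^ k / 810 := fun k =>
    IsAlgClosed.exists_pow_nat_eq _ (by norm_num)
  choose l hl using hroot
  let e : Fin 9 ≃ Fin 3 × Fin 3 := Fintype.equivOfCardEq (by simp)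
  let g : Fin 3 × Fin 3 → MvPolynomial (Fin 3) ℂ := fun m =>
    C (810⁻¹ : ℂ) * (C w ^ (m.1 + m.2 : ℕ) *
      (X 0 + C w ^ (m.1 : ℕ) * X 1 + C w ^ (m.2 : ℕ) * X 2) ^ 6)
  let s : Fin 9 → ℂ := fun n => l ((e n).1 + (e n).2 : ℕ)
  refine ⟨s, fun n => s n * w ^ ((e n).1 : ℕ), fun n => s n * w ^ ((e n).2 : ℕ), ?_⟩
  have hterm : ∀ n, linC (s n) (s n * w ^ ((e n).1 : ℕ)) (s n * w ^ ((e n).2 : ℕ)) ^ 6 =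
      g (e n) := by
    intro n
    have hs : (C (s n) : MvPolynomial (Fin 3) ℂ) ^ 6 =
        C (810⁻¹ : ℂ) * C w ^ ((e n).1 + (e n).2 : ℕ) := by
      rw [← C_pow, hl, ← C_pow, ← C_mul, div_eq_inv_mul]
    simp only [linC, g, C_mul, C_pow]
    rw [← mul_assoc, ← hs]
    ring
  rw [Finset.sum_congr rfl fun n _ => hterm n, Equiv.sum_comp e g, ← Finset.mul_sum,
    Fintype.sum_prod_type, cube_root_waring, ← mul_assoc]
  · have : (C (810⁻¹ : ℂ) * 810 : MvPolynomial (Fin 3) ℂ) = 1 := by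
      rw [← map_ofNat C 810, ← C_mul]
      norm_num
    rw [this, one_mul]
  · simpa using congrArg (C : ℂ → MvPolynomial (Fin 3) ℂ) hw

/-- The complex Waring rank of `x²y²z²` equals 9: the least `r` such that
`x²y²z² = ∑_{i=1}^r (a_i x + b_i y + c_i z)⁶` for some complex `a_i, b_i, c_i` is `9`. -/
theorem statement15 :
    IsLeast {r : ℕ | ∃ a b c : Fin r → ℂ,
      (X 0 ^ 2 * X 1 ^ 2 * X 2 ^ 2 : MvPolynomial (Fin 3) ℂ) =
        ∑ i, linC (a i) (b i) (c i) ^ 6} 9 :=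
  ⟨exists_waring_nine, fun _ ⟨_, _, _, h⟩ => nine_le_of_waring h⟩
end

section
/- If the sextic x²y²z² admits a real Waring decomposition of length at most 12, then it admits a real Waring decomposition of length at most 12 all of whose points lie on the Fermat cubic: there exist s ≤ 12, real numbers μ_1, …, μ_s, and real numbers a_i, b_i, c_i with a_i³ + b_i³ + c_i³ = 0 for each i, such that x²y²z² = ∑_{i=1}^{s} μ_i (a_i x + b_i y + c_i z)⁶. -/
open MvPolynomial

theorem lin_eq_sum (v : Fin 3 → ℝ) : lin (v 0) (v 1) (v 2) = ∑ j, v j • X j := by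
  simp [lin, Fin.sum_univ_three, smul_eq_C_mul]

theorem coeff_lin_pow (v : Fin 3 → ℝ) (s : Fin 3 →₀ ℕ) :
    coeff s (lin (v 0) (v 1) (v 2) ^ (∑ j, s j)) = s.multinomial * ∏ j, v j ^ s j := by
  have hs : s.sum (fun _ m ↦ m) = ∑ j, s j := Finsupp.sum_fintype _ _ fun _ ↦ rfl
  rw [lin_eq_sum, coeff_linearCombination_X_pow_of_fintype, if_pos hs,
    Finsupp.prod_fintype _ _ fun _ ↦ pow_zero _]

theorem sextic_eq_monomial : (X 0 ^ 2 * X 1 ^ 2 * X 2 ^ 2 : MvPolynomial (Fin 3) ℝ) =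
    monomial (Finsupp.equivFunOnFinite.symm fun _ ↦ 2) 1 := by
  rw [MvPolynomial.monomial_eq, Finsupp.prod_fintype _ _ fun _ ↦ pow_zero _]
  simp [Fin.prod_univ_three]

section Decomposition

variable {ι : Type*} [Fintype ι] {lam : ι → ℝ} {v : ι → Fin 3 → ℝ}

theorem coeff_eq_moment
    (h : (X 0 ^ 2 * X 1 ^ 2 * X 2 ^ 2 : MvPolynomial (Fin 3) ℝ) =
      ∑ i, lam i • lin (v i 0) (v i 1) (v i 2) ^ 6)
    (d : Fin 3 → ℕ) (hd : ∑ j, d j = 6) :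
    (if d = fun _ ↦ 2 then (1 : ℝ) else 0) =
      (Finsupp.equivFunOnFinite.symm d).multinomial * ∑ i, lam i * ∏ j, v i j ^ d j := by
  have h' := congrArg (coeff (Finsupp.equivFunOnFinite.symm d)) h
  have hc := fun i ↦ coeff_lin_pow (v i) (Finsupp.equivFunOnFinite.symm d)
  simp only [Finsupp.equivFunOnFinite_symm_apply_apply, hd] at hc
  simp only [sextic_eq_monomial, coeff_monomial, coeff_sum, coeff_smul, hc, smul_eq_mul,
    EmbeddingLike.apply_eq_iff_eq] at h'
  simp only [eq_comm (a := d), h', Finset.mul_sum]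
  exact Finset.sum_congr rfl fun i _ ↦ by ring

theorem moment_eq_zero
    (h : (X 0 ^ 2 * X 1 ^ 2 * X 2 ^ 2 : MvPolynomial (Fin 3) ℝ) =
      ∑ i, lam i • lin (v i 0) (v i 1) (v i 2) ^ 6)
    (d : Fin 3 → ℕ) (hd : ∑ j, d j = 6) (hd2 : d ≠ fun _ ↦ 2) :
    ∑ i, lam i * ∏ j, v i j ^ d j = 0 := by
  have h' := coeff_eq_moment h d hd
  rw [if_neg hd2, eq_comm, mul_eq_zero] at h'
  exact h'.resolve_left (by exact_mod_cast (Nat.multinomial_pos _ _).ne')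

theorem moment_two_ne_zero
    (h : (X 0 ^ 2 * X 1 ^ 2 * X 2 ^ 2 : MvPolynomial (Fin 3) ℝ) =
      ∑ i, lam i • lin (v i 0) (v i 1) (v i 2) ^ 6) :
    ∑ i, lam i * ∏ j, v i j ^ 2 ≠ 0 := by
  intro h0
  have h' := coeff_eq_moment h (fun _ ↦ 2) (by simp)
  rw [h0] at h'
  simp at h'

/-- The exponents of the ternary cubic monomials. -/
abbrev cubicExponents : Finset (Fin 3 → ℕ) := Finset.piAntidiag Finset.univ 3

theorem le_two_or_eq_single :
    ∀ d ∈ cubicExponents, (∀ j, d j ≤ 2) ∨ ∃ k, d = Pi.single k 3 := by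
  decide

/-- A ternary cubic vanishing on the points of a decomposition of `x²y²z²` is a combination of
`x³`, `y³` and `z³`. -/
theorem cubic_coeff_eq_zero
    (h : (X 0 ^ 2 * X 1 ^ 2 * X 2 ^ 2 : MvPolynomial (Fin 3) ℝ) =
      ∑ i, lam i • lin (v i 0) (v i 1) (v i 2) ^ 6)
    (g : (Fin 3 → ℕ) → ℝ)
    (hg : ∀ i, ∑ d ∈ cubicExponents, g d * ∏ j, v i j ^ d j = 0)
    {d : Fin 3 → ℕ} (hd : d ∈ cubicExponents) (hd2 : ∀ j, d j ≤ 2) : g d = 0 := by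
  have hsum : ∀ e ∈ cubicExponents, ∑ j, (e j + (2 - d j)) = 6 := by
    intro e he
    have h1 := (Finset.mem_piAntidiag.1 he).1
    have h2 := (Finset.mem_piAntidiag.1 hd).1
    have := hd2 0
    have := hd2 1
    have := hd2 2
    rw [Fin.sum_univ_three] at *
    omega
  have key : ∑ e ∈ cubicExponents, g e * ∑ i, lam i * ∏ j, v i j ^ (e j + (2 - d j)) = 0 := by
    calc _ = ∑ i, lam i * (∏ j, v i j ^ (2 - d j)) *
          ∑ e ∈ cubicExponents, g e * ∏ j, v i j ^ e j := by
          simp only [Finset.mul_sum]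
          rw [Finset.sum_comm]
          refine Finset.sum_congr rfl fun i _ ↦ Finset.sum_congr rfl fun e _ ↦ ?_
          simp only [pow_add, Finset.prod_mul_distrib]
          ring
      _ = 0 := by simp [hg]
  rw [Finset.sum_eq_single_of_mem d hd] at key
  · have h2 : ∀ j, d j + (2 - d j) = 2 := fun j ↦ Nat.add_sub_of_le (hd2 j)
    simp only [h2] at key
    exact (mul_eq_zero.1 key).resolve_right (moment_two_ne_zero h)
  · intro e he hne
    rw [moment_eq_zero h _ (hsum e he), mul_zero]
    refine fun h2 ↦ hne (funext fun j ↦ ?_)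
    have := congrFun h2 j
    have := hd2 j
    omega

/-- The points of a decomposition of `x²y²z²` with at most twelve nonzero terms lie on a cubic
`α x³ + β y³ + γ z³ = 0`. -/
theorem exists_cubic_of_card_le
    (h : (X 0 ^ 2 * X 1 ^ 2 * X 2 ^ 2 : MvPolynomial (Fin 3) ℝ) =
      ∑ i, lam i • lin (v i 0) (v i 1) (v i 2) ^ 6)
    (hlam : ∀ i, lam i ≠ 0) (hcard : Fintype.card ι ≤ 12) :
    ∃ α : Fin 3 → ℝ, α ≠ 0 ∧ ∀ i, ∑ j, α j * v i j ^ 3 = 0 := by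
  classical
  let A : Matrix cubicExponents ι ℝ := .of fun d i ↦ ∏ j, v i j ^ d.1 j
  let B : Matrix ι (Fin 3) ℝ := .of fun i j ↦ lam i * v i j ^ 3
  have hB : ∀ α, B.mulVecLin α = 0 → ∀ i, ∑ j, α j * v i j ^ 3 = 0 := by
    intro α hα i
    have hi := congrFun hα i
    simp only [B, Matrix.mulVecLin_apply, Matrix.mulVec, dotProduct, Matrix.of_apply,
      Pi.zero_apply] at hi
    refine (mul_eq_zero.1 (Eq.trans ?_ hi)).resolve_left (hlam i)
    rw [Finset.mul_sum]
    exact Finset.sum_congr rfl fun j _ ↦ by ring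
  have hsingle : ∀ i k, ∏ j, v i j ^ (Pi.single k 3 : Fin 3 → ℕ) j = v i k ^ 3 := by
    intro i k
    rw [Finset.prod_eq_single k] <;> simp +contextual
  by_cases hinj : Function.Injective B.mulVecLin
  · have hrange : LinearMap.range B.mulVecLin ≤ LinearMap.ker A.mulVecLin := by
      rintro _ ⟨α, rfl⟩
      ext d
      have hd := (Finset.mem_piAntidiag.1 d.2).1
      have hm : ∀ k, ∑ i, lam i * ∏ j, v i j ^ (d.1 j + (Pi.single k 3 : Fin 3 → ℕ) j) = 0 := by
        intro k
        refine moment_eq_zero h _ ?_ fun h2 ↦ ?_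
        · rw [Finset.sum_add_distrib, hd, Finset.sum_pi_single']
          simp
        · have := congrFun h2 k
          simp at this
      have hm' : ∀ k, ∑ i, (∏ j, v i j ^ d.1 j) * (lam i * v i k ^ 3) = 0 := by
        intro k
        rw [← hm k]
        refine Finset.sum_congr rfl fun i _ ↦ ?_
        simp only [pow_add, Finset.prod_mul_distrib, hsingle]
        ring
      simp only [A, B, Matrix.mulVecLin_apply, Matrix.mulVec, dotProduct, Matrix.of_apply,
        Pi.zero_apply, Finset.mul_sum]
      rw [Finset.sum_comm]
      refine Finset.sum_eq_zero fun k _ ↦ ?_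
      simp only [← mul_assoc] at hm' ⊢
      rw [← Finset.sum_mul, hm', zero_mul]
    have hker : 3 ≤ Module.finrank ℝ (LinearMap.ker A.mulVecLin) := by
      have := Submodule.finrank_mono hrange
      rwa [LinearMap.finrank_range_of_inj hinj, Module.finrank_fin_fun] at this
    have hcard10 : Fintype.card cubicExponents = 10 := by
      rw [Fintype.card_coe]
      decide
    have hlt : LinearMap.range A.mulVecLin < ⊤ := by
      refine lt_top_iff_ne_top.2 fun htop ↦ ?_
      have hrk := LinearMap.finrank_range_add_finrank_ker A.mulVecLin
      rw [htop, finrank_top, Module.finrank_fintype_fun_eq_card,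
        Module.finrank_fintype_fun_eq_card, hcard10] at hrk
      omega
    obtain ⟨φ, hφ, hφA⟩ := Submodule.exists_dual_map_eq_bot_of_lt_top hlt inferInstance
    let g : (Fin 3 → ℕ) → ℝ := fun d ↦
      if hd : d ∈ cubicExponents then φ (Pi.single ⟨d, hd⟩ 1) else 0
    have hφg : ∀ f, φ f = ∑ d : cubicExponents, g d * f d := by
      intro f
      rw [LinearMap.pi_apply_eq_sum_univ φ f]
      refine Finset.sum_congr rfl fun d _ ↦ ?_
      simp only [g, d.2, dif_pos, smul_eq_mul, mul_comm]
      congr 2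
      ext e
      simp [Pi.single_apply, eq_comm]
    have hg : ∀ i, ∑ d ∈ cubicExponents, g d * ∏ j, v i j ^ d j = 0 := by
      intro i
      have hi : φ (A.mulVecLin (Pi.single i 1)) = 0 := by
        have := Submodule.mem_map_of_mem (f := φ)
          (LinearMap.mem_range_self A.mulVecLin (Pi.single i 1))
        rwa [hφA, Submodule.mem_bot] at this
      rw [hφg] at hi
      rw [← Finset.sum_coe_sort, ← hi]
      simp [A]
    have hg0 := fun d hd hd2 ↦ cubic_coeff_eq_zero h g hg (d := d) hd hd2
    refine ⟨fun j ↦ g (Pi.single j 3), fun h0 ↦ hφ ?_, fun i ↦ ?_⟩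
    · refine LinearMap.ext fun f ↦ ?_
      rw [hφg, LinearMap.zero_apply]
      refine Finset.sum_eq_zero fun d _ ↦ ?_
      rcases le_two_or_eq_single d.1 d.2 with hd | ⟨k, hk⟩
      · rw [hg0 d d.2 hd, zero_mul]
      · have := congrFun h0 k
        simp only [Pi.zero_apply] at this
        rw [hk, this, zero_mul]
    · rw [← hg i]
      refine Finset.sum_of_injOn (fun k ↦ Pi.single k 3) ?_ ?_ ?_ ?_
      · intro k _ l _ hkl
        by_contra hne
        have := congrFun hkl k
        simp [hne] at this
      · intro k _
        simp [Finset.mem_piAntidiag]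
      · intro d hd hdk
        rcases le_two_or_eq_single d hd with hd2 | ⟨k, hk⟩
        · rw [hg0 d hd hd2, zero_mul]
        · exact absurd ⟨k, by simp, hk.symm⟩ hdk
      · intro k _
        simp only [hsingle]
  · rw [← LinearMap.ker_eq_bot, ← ne_eq, Submodule.ne_bot_iff] at hinj
    obtain ⟨α, hα, hα0⟩ := hinj
    exact ⟨α, hα0, hB α hα⟩

theorem eval_decomposition
    (h : (X 0 ^ 2 * X 1 ^ 2 * X 2 ^ 2 : MvPolynomial (Fin 3) ℝ) =
      ∑ i, lam i • lin (v i 0) (v i 1) (v i 2) ^ 6) (p : Fin 3 → ℝ) :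
    p 0 ^ 2 * p 1 ^ 2 * p 2 ^ 2 =
      ∑ i, lam i * (v i 0 * p 0 + v i 1 * p 1 + v i 2 * p 2) ^ 6 := by
  simpa [lin, smul_eval] using congrArg (eval p) h

/-- The points of a decomposition of `x²y²z²` do not lie on a line. -/
theorem eq_zero_of_forall_linear_eq_zero
    (h : (X 0 ^ 2 * X 1 ^ 2 * X 2 ^ 2 : MvPolynomial (Fin 3) ℝ) =
      ∑ i, lam i • lin (v i 0) (v i 1) (v i 2) ^ 6)
    {u : Fin 3 → ℝ} (hu : ∀ i, lam i ≠ 0 → ∑ j, u j * v i j = 0) : u = 0 := by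
  have htrans : ∀ p : Fin 3 → ℝ, (p 0 + u 0) ^ 2 * (p 1 + u 1) ^ 2 * (p 2 + u 2) ^ 2 =
      p 0 ^ 2 * p 1 ^ 2 * p 2 ^ 2 := by
    intro p
    rw [eval_decomposition h p, ← Pi.add_apply, ← Pi.add_apply, ← Pi.add_apply,
      eval_decomposition h]
    refine Finset.sum_congr rfl fun i _ ↦ ?_
    by_cases hi : lam i = 0
    · simp [hi]
    · have := hu i hi
      rw [Fin.sum_univ_three] at this
      simp only [Pi.add_apply]
      congr 2
      linear_combination this
  have h0 := htrans ![0, 1 - u 1, 1 - u 2]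
  have h1 := htrans ![1 - u 0, 0, 1 - u 2]
  have h2 := htrans ![1 - u 0, 1 - u 1, 0]
  ext j
  fin_cases j <;> simp_all

theorem exists_cube_eq (x : ℝ) : ∃ s : ℝ, s ^ 3 = x := by
  have hnonneg : ∀ y : ℝ, 0 ≤ y → ∃ s : ℝ, s ^ 3 = y := fun y hy ↦
    ⟨y ^ ((3 : ℕ) : ℝ)⁻¹, Real.rpow_inv_natCast_pow hy three_ne_zero⟩
  rcases le_total 0 x with hx | hx
  · exact hnonneg x hx
  · obtain ⟨s, hs⟩ := hnonneg (-x) (by linarith)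
    exact ⟨-s, by linear_combination -hs⟩

/-- A cubic `α x³ + β y³ + γ z³` through the points of a decomposition of `x²y²z²` has nonzero
coefficients. -/
theorem cubic_coeff_ne_zero
    (h : (X 0 ^ 2 * X 1 ^ 2 * X 2 ^ 2 : MvPolynomial (Fin 3) ℝ) =
      ∑ i, lam i • lin (v i 0) (v i 1) (v i 2) ^ 6)
    {s : Fin 3 → ℝ} (hs : s ≠ 0)
    (hsv : ∀ i, lam i ≠ 0 → ∑ j, (s j * v i j) ^ 3 = 0) (k : Fin 3) : s k ≠ 0 := by
  intro hk
  refine hs (eq_zero_of_forall_linear_eq_zero h fun i hi ↦ ?_)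
  have hcube : ∀ x y : ℝ, x ^ 3 + y ^ 3 = 0 → x + y = 0 := by
    intro x y hxy
    have : x ^ 3 = (-y) ^ 3 := by linear_combination hxy
    linear_combination (Odd.strictMono_pow (by decide : Odd 3)).injective this
  have hi := hsv i hi
  rw [Fin.sum_univ_three] at hi ⊢
  fin_cases k <;> simp_all

end Decomposition

/-- If the sextic `x²y²z²` admits a real Waring decomposition of length at
most 12, then it admits one of length at most 12 all of whose points lie on the Fermat
cubic `x³ + y³ + z³ = 0`. -/
theorem statement16
    (h : ∃ (r : ℕ), r ≤ 12 ∧ ∃ lam a b c : Fin r → ℝ,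
        (X 0 ^ 2 * X 1 ^ 2 * X 2 ^ 2 : MvPolynomial (Fin 3) ℝ) =
          ∑ i, lam i • lin (a i) (b i) (c i) ^ 6) :
    ∃ (s : ℕ), s ≤ 12 ∧ ∃ mu a b c : Fin s → ℝ,
      (∀ i, a i ^ 3 + b i ^ 3 + c i ^ 3 = 0) ∧
      (X 0 ^ 2 * X 1 ^ 2 * X 2 ^ 2 : MvPolynomial (Fin 3) ℝ) =
        ∑ i, mu i • lin (a i) (b i) (c i) ^ 6 := by
  obtain ⟨r, hr, lam, a, b, c, h⟩ := h
  let v : Fin r → Fin 3 → ℝ := fun i ↦ ![a i, b i, c i]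
  have hv : (X 0 ^ 2 * X 1 ^ 2 * X 2 ^ 2 : MvPolynomial (Fin 3) ℝ) =
      ∑ i, lam i • lin (v i 0) (v i 1) (v i 2) ^ 6 := h
  have hsub : (X 0 ^ 2 * X 1 ^ 2 * X 2 ^ 2 : MvPolynomial (Fin 3) ℝ) =
      ∑ i : {i // lam i ≠ 0}, lam i • lin (v i 0) (v i 1) (v i 2) ^ 6 := by
    rw [hv, ← Finset.sum_filter_of_ne (p := fun i ↦ lam i ≠ 0)]
    · exact (Finset.sum_subtype _ (by simp) _)
    · intro i _ hi h0
      simp [h0] at hi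
  obtain ⟨α, hα, hαv⟩ := exists_cubic_of_card_le hsub (fun i ↦ i.2)
    ((Fintype.card_subtype_le _).trans (by simpa using hr))
  choose s hs using fun j ↦ exists_cube_eq (α j)
  have hs0 : s ≠ 0 := by
    rintro rfl
    exact hα (funext fun j ↦ by simp [← hs])
  have hsv : ∀ i, lam i ≠ 0 → ∑ j, (s j * v i j) ^ 3 = 0 := by
    intro i hi
    simpa only [mul_pow, hs] using hαv ⟨i, hi⟩
  have hsk := cubic_coeff_ne_zero hv hs0 hsv
  let w : Fin r → Fin 3 → ℝ := fun i j ↦ if lam i = 0 then 0 else s j * v i j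
  have hscale := congrArg (aeval fun j ↦ C (s j) * (X j : MvPolynomial (Fin 3) ℝ)) h
  refine ⟨r, hr, fun i ↦ ((s 0 * s 1 * s 2) ^ 2)⁻¹ * lam i, fun i ↦ w i 0, fun i ↦ w i 1,
    fun i ↦ w i 2, fun i ↦ ?_, ?_⟩
  · by_cases hi : lam i = 0
    · simp [w, hi]
    · simpa [w, hi, Fin.sum_univ_three] using hsv i hi
  · have hterm : ∀ i, lam i • lin (w i 0) (w i 1) (w i 2) ^ 6 =
        aeval (fun j ↦ C (s j) * (X j : MvPolynomial (Fin 3) ℝ))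
          (lam i • lin (a i) (b i) (c i) ^ 6) := by
      intro i
      by_cases hi : lam i = 0
      · simp [hi]
      · simp only [w, hi, v, lin, if_false, map_smul, map_pow, map_add, map_mul, aeval_X,
          algHom_C, algebraMap_eq, Matrix.cons_val]
        congr 2
        ring
    simp only [mul_smul, hterm, ← Finset.smul_sum]
    rw [← map_sum, ← h, eq_inv_smul_iff₀ (by simp [hsk])]
    simp only [map_mul, map_pow, aeval_X, smul_eq_C_mul]
    ring
end

section
/- Let λ be a real number with 0 < λ < 6. Then for every (a,b,c) ∈ ℝ³ with (a,b,c) ≠ (0,0,0) there exist (x,y,z) ∈ ℝ³ with (x,y,z) ≠ (0,0,0) and a real number μ ≠ 0 such that λx² − 6yz = μa, λy² − 6xz = μb, and λz² − 6xy = μc. In other words, every fiber of the map of real projective planes induced by (λx² − 6yz, λy² − 6xz, λz² − 6xy) contains a real point. -/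
open LinearMap (BilinForm)

/-- A quadratic form which takes both signs on the plane spanned by `p` and `n` has two isotropic
vectors there that are not orthogonal to each other. -/
lemma exists_isotropic_pair {V : Type*} [AddCommGroup V] [Module ℝ V] (B : BilinForm ℝ V)
    (hB : ∀ v w, B v w = B w v) {p n : V} (hp : 0 < B p p) (hn : B n n < 0) :
    ∃ x y, B x x = 0 ∧ B y y = 0 ∧ B x y ≠ 0 := by
  have hD : 0 < B p n ^ 2 - B n n * B p p := by nlinarith [mul_pos hp (neg_pos.2 hn)]
  obtain ⟨d, hd0, hd⟩ : ∃ d, 0 < d ∧ d ^ 2 = B p n ^ 2 - B n n * B p p :=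
    ⟨√_, Real.sqrt_pos.2 hD, Real.sq_sqrt hD.le⟩
  refine ⟨B n n • p + (-B p n + d) • n, B n n • p + (-B p n - d) • n, ?_, ?_, ?_⟩
  · simp only [map_add, map_smul, LinearMap.add_apply, LinearMap.smul_apply, smul_eq_mul, hB n p]
    linear_combination B n n * hd
  · simp only [map_add, map_smul, LinearMap.add_apply, LinearMap.smul_apply, smul_eq_mul, hB n p]
    linear_combination B n n * hd
  · simp only [map_add, map_smul, LinearMap.add_apply, LinearMap.smul_apply, smul_eq_mul, hB n p]
    have : B n n * (d ^ 2) < 0 := mul_neg_of_neg_of_pos hn (by positivity)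
    intro h
    nlinarith

/-- Two quadratic forms on a real three-dimensional space, the first of which is degenerate and
indefinite while the second is positive on a kernel vector of the first, either have a common
nontrivial zero or span a pencil containing a positive definite form. -/
lemma exists_common_zero_or_posDef {V : Type*} [AddCommGroup V] [Module ℝ V]
    (hV : Module.finrank ℝ V = 3) (B C : BilinForm ℝ V)
    (hB : ∀ v w, B v w = B w v) (hC : ∀ v w, C v w = C w v)
    {k p n : V} (hk : ∀ v, B k v = 0) (hkC : 0 < C k k) (hp : 0 < B p p) (hn : B n n < 0) :
    (∃ v ≠ 0, B v v = 0 ∧ C v v = 0) ∨ ∃ t : ℝ, ∀ v ≠ 0, 0 < C v v + t * B v v := by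
  obtain ⟨x, y, hx, hy, hxy⟩ := exists_isotropic_pair B hB hp hn
  have lift : ∀ z w, B z z = 0 → B z w ≠ 0 → C z z * C k k ≤ C z k ^ 2 →
      ∃ v ≠ 0, B v v = 0 ∧ C v v = 0 := by
    intro z w hz hzw h
    obtain ⟨t, ht⟩ := exists_quadratic_eq_zero (a := C k k) (b := 2 * C z k) (c := C z z) hkC.ne'
      ⟨2 * √(C z k ^ 2 - C z z * C k k), by
        have := Real.sq_sqrt (sub_nonneg.2 h)
        rw [discrim]
        linear_combination -4 * this⟩
    refine ⟨z + t • k, fun h0 => hzw ?_, ?_, ?_⟩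
    · have := congrArg (fun v => B v w) h0
      simpa [hk] using this
    · simp [hk, hz, hB z k]
    · simp only [map_add, map_smul, LinearMap.add_apply, LinearMap.smul_apply, smul_eq_mul, hC k z]
      linear_combination ht
  by_cases hQx : C x x * C k k ≤ C x k ^ 2
  · exact .inl (lift x y hx hxy hQx)
  by_cases hQy : C y y * C k k ≤ C y k ^ 2
  · exact .inl (lift y x hy (hB x y ▸ hxy) hQy)
  rw [not_le] at hQx hQy
  have hk0 : k ≠ 0 := by
    rintro rfl
    simp at hkC
  have hli : LinearIndependent ℝ ![x, y, k] := by
    rw [Fintype.linearIndependent_iff]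
    intro g hg
    simp only [Fin.sum_univ_three, Matrix.cons_val] at hg
    have h1 : g 1 = 0 := by
      have := congrArg (fun v => B v x) hg
      simpa [hk, hx, hB y x, hxy] using this
    have h0 : g 0 = 0 := by
      have := congrArg (fun v => B v y) hg
      simpa [hk, hy, hxy] using this
    have h2 : g 2 = 0 := by simpa [h0, h1, hk0] using hg
    intro i
    fin_cases i <;> assumption
  refine .inr ⟨-(C k k * C x y - C x k * C y k) / (C k k * B x y), fun v hv => ?_⟩
  have : FiniteDimensional ℝ V := Module.finite_of_finrank_eq_succ hV
  have hspan := hli.span_eq_top_of_card_eq_finrank' (by simp [hV])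
  obtain ⟨g, rfl⟩ := (Submodule.mem_span_range_iff_exists_fun ℝ).1
    (hspan ▸ Submodule.mem_top : v ∈ Submodule.span ℝ (Set.range ![x, y, k]))
  simp only [Fin.sum_univ_three, Matrix.cons_val] at hv ⊢
  generalize g 0 = α, g 1 = β, g 2 = γ at hv ⊢
  have key : C k k * (C (α • x + β • y + γ • k) (α • x + β • y + γ • k) +
      -(C k k * C x y - C x k * C y k) / (C k k * B x y) *
        B (α • x + β • y + γ • k) (α • x + β • y + γ • k)) =
      (C k k * γ + α * C x k + β * C y k) ^ 2 + α ^ 2 * (C x x * C k k - C x k ^ 2) +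
        β ^ 2 * (C y y * C k k - C y k ^ 2) := by
    simp only [map_add, map_smul, LinearMap.add_apply, LinearMap.smul_apply, smul_eq_mul, hk, hx,
      hy, hB x k, hB y k, hB y x, hC k x, hC k y, hC y x]
    have := hkC.ne'
    field_simp
    ring
  refine pos_of_mul_pos_right (key ▸ ?_) hkC.le
  have hx' := sub_pos.2 hQx
  have hy' := sub_pos.2 hQy
  by_cases hα : α = 0
  · by_cases hβ : β = 0
    · have : γ ≠ 0 := by
        rintro rfl
        simp [hα, hβ] at hv
      subst hα hβ
      have := hkC.ne'
      simp only [zero_mul, add_zero]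
      positivity
    · positivity
  · positivity

/-- The Gram matrix of twice the quadric
`u₀ (l x² - 6 y z) + u₁ (l y² - 6 x z) + u₂ (l z² - 6 x y)` of the Hesse net. -/
def hesseNet (l : ℝ) (u : Fin 3 → ℝ) : Matrix (Fin 3) (Fin 3) ℝ :=
  !![2 * l * u 0, -6 * u 2, -6 * u 1;
     -6 * u 2, 2 * l * u 1, -6 * u 0;
     -6 * u 1, -6 * u 0, 2 * l * u 2]

lemma toBilin'_hesseNet (l : ℝ) (u v w : Fin 3 → ℝ) :
    Matrix.toBilin' (hesseNet l u) v w =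
      u 0 * (2 * l * v 0 * w 0 - 6 * (v 1 * w 2 + v 2 * w 1)) +
      u 1 * (2 * l * v 1 * w 1 - 6 * (v 0 * w 2 + v 2 * w 0)) +
      u 2 * (2 * l * v 2 * w 2 - 6 * (v 0 * w 1 + v 1 * w 0)) := by
  simp [Matrix.toBilin'_apply, hesseNet, Fin.sum_univ_three]
  ring

lemma toBilin'_hesseNet_comm (l : ℝ) (u v w : Fin 3 → ℝ) :
    Matrix.toBilin' (hesseNet l u) v w = Matrix.toBilin' (hesseNet l u) w v := by
  simp only [toBilin'_hesseNet]
  ring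

/-- No nonzero member of the Hesse net is positive semidefinite when `0 < l < 6`. -/
lemma exists_hesseNet_neg {l : ℝ} (h0 : 0 < l) (h6 : l < 6) {u : Fin 3 → ℝ} (hu : u ≠ 0) :
    ∃ v, Matrix.toBilin' (hesseNet l u) v v < 0 := by
  by_contra! h
  have e0 := h ![1, 0, 0]
  have e1 := h ![0, 1, 0]
  have e2 := h ![0, 0, 1]
  have e := h ![1, 1, 1]
  simp only [toBilin'_hesseNet, Matrix.cons_val] at e0 e1 e2 e
  have p0 : 0 ≤ u 0 := by by_contra! hc; nlinarith
  have p1 : 0 ≤ u 1 := by by_contra! hc; nlinarith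
  have p2 : 0 ≤ u 2 := by by_contra! hc; nlinarith
  have hs : u 0 + u 1 + u 2 ≤ 0 := by by_contra! hc; nlinarith
  apply hu
  ext i
  fin_cases i <;> simp <;> linarith

lemma sum_sq_pos {a b c : ℝ} (h : (a, b, c) ≠ (0, 0, 0)) : 0 < a ^ 2 + b ^ 2 + c ^ 2 := by
  by_contra! hc
  apply h
  have ha : a = 0 := by nlinarith [sq_nonneg a, sq_nonneg b, sq_nonneg c]
  have hb : b = 0 := by nlinarith [sq_nonneg a, sq_nonneg b, sq_nonneg c]
  have hc : c = 0 := by nlinarith [sq_nonneg a, sq_nonneg b, sq_nonneg c]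
  rw [ha, hb, hc]

/-- Every real line of the Hesse net contains a degenerate quadric. -/
lemma exists_det_hesseNet_eq_zero (l a b c : ℝ) (h : (a, b, c) ≠ (0, 0, 0)) :
    ∃ u : Fin 3 → ℝ, u ≠ 0 ∧ a * u 0 + b * u 1 + c * u 2 = 0 ∧ (hesseNet l u).det = 0 := by
  obtain ⟨w, hw, haw⟩ : ∃ w : Fin 3 → ℝ, w ≠ 0 ∧ a * w 0 + b * w 1 + c * w 2 = 0 := by
    by_cases hab : a = 0 ∧ b = 0
    · exact ⟨![1, 0, 0], fun h => by simpa using congrFun h 0, by simp [hab.1]⟩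
    · refine ⟨![-b, a, 0], fun h => hab ?_, by simp; ring⟩
      exact ⟨by simpa using congrFun h 1, by simpa using congrFun h 0⟩
  have hN := sum_sq_pos h
  let w' : Fin 3 → ℝ := ![b * w 2 - c * w 1, c * w 0 - a * w 2, a * w 1 - b * w 0]
  let f : ℝ → Fin 3 → ℝ := fun t => Real.cos t • w + Real.sin t • w'
  have hf : Continuous fun t => (hesseNet l (f t)).det := by
    simp only [f, hesseNet, Matrix.det_fin_three, Matrix.of_apply, Matrix.cons_val, Pi.add_apply,
      Pi.smul_apply, smul_eq_mul]
    fun_prop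
  have hodd : (hesseNet l (f Real.pi)).det = -(hesseNet l (f 0)).det := by
    simp [f, hesseNet, Matrix.det_fin_three]
    ring
  obtain ⟨t, ht⟩ : ∃ t, (hesseNet l (f t)).det = 0 := by
    rcases le_total 0 (hesseNet l (f 0)).det with h | h
    · exact mem_range_of_exists_le_of_exists_ge hf ⟨Real.pi, by linarith⟩ ⟨0, h⟩
    · exact mem_range_of_exists_le_of_exists_ge hf ⟨0, h⟩ ⟨Real.pi, by linarith⟩
  refine ⟨f t, fun hft => hw ?_, ?_, ht⟩
  · have g0 := congrFun hft 0
    have g1 := congrFun hft 1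
    have g2 := congrFun hft 2
    simp only [f, w', Pi.add_apply, Pi.smul_apply, smul_eq_mul, Matrix.cons_val,
      Pi.zero_apply] at g0 g1 g2
    have hW : w 0 ^ 2 + w 1 ^ 2 + w 2 ^ 2 = 0 := by
      have hc : Real.cos t * (w 0 ^ 2 + w 1 ^ 2 + w 2 ^ 2) = 0 := by
        linear_combination w 0 * g0 + w 1 * g1 + w 2 * g2
      have hs : Real.sin t * ((a ^ 2 + b ^ 2 + c ^ 2) * (w 0 ^ 2 + w 1 ^ 2 + w 2 ^ 2)) = 0 := by
        linear_combination (b * w 2 - c * w 1) * g0 + (c * w 0 - a * w 2) * g1 +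
          (a * w 1 - b * w 0) * g2 + Real.sin t * (a * w 0 + b * w 1 + c * w 2) * haw
      rcases mul_eq_zero.1 hc with hc | hc
      · rcases mul_eq_zero.1 hs with hs | hs
        · have := Real.sin_sq_add_cos_sq t
          simp [hc, hs] at this
        · exact (mul_eq_zero.1 hs).resolve_left hN.ne'
      · exact hc
    ext i
    fin_cases i <;> simp <;> nlinarith [sq_nonneg (w 0), sq_nonneg (w 1), sq_nonneg (w 2)]
  · simp only [f, w', Pi.add_apply, Pi.smul_apply, smul_eq_mul, Matrix.cons_val]
    linear_combination Real.cos t * haw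

/-- The base locus of the Hesse net has no nonzero real point when `0 < l < 6`. -/
lemma eq_zero_of_hesse_quadrics_eq_zero {l x y z : ℝ} (h0 : 0 < l) (h6 : l < 6)
    (hx : l * x ^ 2 - 6 * (y * z) = 0) (hy : l * y ^ 2 - 6 * (x * z) = 0)
    (hz : l * z ^ 2 - 6 * (x * y) = 0) : x = 0 ∧ y = 0 ∧ z = 0 := by
  have hl : (216 - l ^ 3) * (x * y * z) ^ 2 = 0 := by
    linear_combination (-(l * y ^ 2) * (l * z ^ 2)) * hx - 6 * (y * z) * (l * z ^ 2) * hy -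
      6 * (y * z) * (6 * (x * z)) * hz
  have hl3 : 216 - l ^ 3 ≠ 0 := by
    nlinarith [mul_pos h0 (sub_pos.2 h6), mul_pos (mul_pos h0 h0) (sub_pos.2 h6)]
  have hxyz : x * y * z = 0 := by simpa [hl3] using hl
  have hl0 := h0.ne'
  have cube : ∀ t, l * t ^ 3 = 0 → t = 0 := fun t ht => by simpa [hl0] using ht
  exact ⟨cube x (by linear_combination x * hx + 6 * hxyz),
    cube y (by linear_combination y * hy + 6 * hxyz),
    cube z (by linear_combination z * hz + 6 * hxyz)⟩

/-- Two quadrics of the Hesse net, the first of them degenerate, have a common real point when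
they are linearly independent and `0 < l < 6`. -/
lemma exists_common_zero_hesseNet {l : ℝ} (h0 : 0 < l) (h6 : l < 6) {u w : Fin 3 → ℝ}
    (hu : u ≠ 0) (hdet : (hesseNet l u).det = 0) (huw : ∀ t : ℝ, w + t • u ≠ 0) :
    ∃ v ≠ 0, Matrix.toBilin' (hesseNet l u) v v = 0 ∧ Matrix.toBilin' (hesseNet l w) v v = 0 := by
  obtain ⟨k, hk0, hk⟩ := Matrix.exists_mulVec_eq_zero_iff.2 hdet
  have hk : ∀ v, Matrix.toBilin' (hesseNet l u) k v = 0 := fun v => by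
    rw [toBilin'_hesseNet_comm, Matrix.toBilin'_apply', hk, dotProduct_zero]
  have neg_u : ∀ (u v : Fin 3 → ℝ), Matrix.toBilin' (hesseNet l (-u)) v v =
      -Matrix.toBilin' (hesseNet l u) v v := fun u v => by
    simp only [toBilin'_hesseNet, Pi.neg_apply]
    ring
  obtain ⟨n, hn⟩ := exists_hesseNet_neg h0 h6 hu
  obtain ⟨p, hp⟩ := exists_hesseNet_neg h0 h6 (neg_ne_zero.2 hu)
  rw [neg_u, neg_lt_zero] at hp
  have main : ∀ w : Fin 3 → ℝ, (∀ t : ℝ, w + t • u ≠ 0) →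
      0 < Matrix.toBilin' (hesseNet l w) k k →
      ∃ v ≠ 0, Matrix.toBilin' (hesseNet l u) v v = 0 ∧
        Matrix.toBilin' (hesseNet l w) v v = 0 := by
    intro w huw hkw
    refine (exists_common_zero_or_posDef (by simp) _ _ (toBilin'_hesseNet_comm l u)
      (toBilin'_hesseNet_comm l w) hk hkw hp hn).resolve_right ?_
    rintro ⟨t, ht⟩
    obtain ⟨v, hv⟩ := exists_hesseNet_neg h0 h6 (huw t)
    have hv0 : v ≠ 0 := by
      rintro rfl
      simp at hv
    have := ht v hv0
    simp only [toBilin'_hesseNet, Pi.add_apply, Pi.smul_apply, smul_eq_mul] at this hv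
    linarith
  rcases lt_trichotomy (Matrix.toBilin' (hesseNet l w) k k) 0 with h | h | h
  · obtain ⟨v, hv0, hv, hv'⟩ := main (-w) (fun t ht => huw (-t) (by
      rw [← neg_eq_zero, ← ht, neg_add, neg_smul, neg_neg])) (by rwa [neg_u, neg_pos])
    exact ⟨v, hv0, hv, by rwa [neg_u, neg_eq_zero] at hv'⟩
  · exact ⟨k, hk0, hk k, h⟩
  · exact main w huw h

/-- Let `0 < λ < 6`. For every `(a,b,c) ∈ ℝ³ \ {0}` there exist
`(x,y,z) ∈ ℝ³ \ {0}` and `μ ≠ 0` with `λx² − 6yz = μa`, `λy² − 6xz = μb`,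
`λz² − 6xy = μc`: every fiber of the induced map `ℙ²(ℝ) → ℙ²(ℝ)` contains a real point. -/
theorem statement18 (l : ℝ) (h0 : 0 < l) (h6 : l < 6) :
    ∀ a b c : ℝ, (a, b, c) ≠ (0, 0, 0) →
      ∃ x y z μ : ℝ, (x, y, z) ≠ (0, 0, 0) ∧ μ ≠ 0 ∧
        l * x ^ 2 - 6 * (y * z) = μ * a ∧
        l * y ^ 2 - 6 * (x * z) = μ * b ∧
        l * z ^ 2 - 6 * (x * y) = μ * c := by
  intro a b c h
  obtain ⟨u, hu, hau, hdet⟩ := exists_det_hesseNet_eq_zero l a b c h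
  have hN := sum_sq_pos h
  have hU : u 0 ^ 2 + u 1 ^ 2 + u 2 ^ 2 ≠ 0 := fun hU => hu <| by
    ext i
    fin_cases i <;> simp <;> nlinarith [sq_nonneg (u 0), sq_nonneg (u 1), sq_nonneg (u 2)]
  obtain ⟨v, hv0, hv, hv'⟩ := exists_common_zero_hesseNet h0 h6 hu hdet
    (w := ![b * u 2 - c * u 1, c * u 0 - a * u 2, a * u 1 - b * u 0]) (fun t ht => by
      have g0 := congrFun ht 0
      have g1 := congrFun ht 1
      have g2 := congrFun ht 2
      simp only [Pi.add_apply, Pi.smul_apply, smul_eq_mul, Matrix.cons_val,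
        Pi.zero_apply] at g0 g1 g2
      have : (a ^ 2 + b ^ 2 + c ^ 2) * (u 0 ^ 2 + u 1 ^ 2 + u 2 ^ 2) = 0 := by
        linear_combination (b * u 2 - c * u 1) * g0 + (c * u 0 - a * u 2) * g1 +
          (a * u 1 - b * u 0) * g2 + (a * u 0 + b * u 1 + c * u 2) * hau
      exact (mul_ne_zero hN.ne' hU) this)
  simp only [toBilin'_hesseNet, Matrix.cons_val] at hv hv'
  set X := l * v 0 ^ 2 - 6 * (v 1 * v 2) with hX
  set Y := l * v 1 ^ 2 - 6 * (v 0 * v 2) with hY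
  set Z := l * v 2 ^ 2 - 6 * (v 0 * v 1) with hZ
  have e : X * u 0 + Y * u 1 + Z * u 2 = 0 := by
    rw [hX, hY, hZ]
    linear_combination hv / 2
  have e' : (Y * c - Z * b) * u 0 + (Z * a - X * c) * u 1 + (X * b - Y * a) * u 2 = 0 := by
    rw [hX, hY, hZ]
    linear_combination hv' / 2
  have n0 : Y * c - Z * b = 0 := mul_right_cancel₀ hU <| by
    linear_combination u 0 * e' + (u 1 * c - u 2 * b) * e - (u 1 * Z - u 2 * Y) * hau
  have n1 : Z * a - X * c = 0 := mul_right_cancel₀ hU <| by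
    linear_combination u 1 * e' + (u 2 * a - u 0 * c) * e - (u 2 * X - u 0 * Z) * hau
  have n2 : X * b - Y * a = 0 := mul_right_cancel₀ hU <| by
    linear_combination u 2 * e' + (u 0 * b - u 1 * a) * e - (u 0 * Y - u 1 * X) * hau
  have hXe : X = (X * a + Y * b + Z * c) / (a ^ 2 + b ^ 2 + c ^ 2) * a := by
    field_simp
    linear_combination b * n2 - c * n1
  have hYe : Y = (X * a + Y * b + Z * c) / (a ^ 2 + b ^ 2 + c ^ 2) * b := by
    field_simp
    linear_combination c * n0 - a * n2
  have hZe : Z = (X * a + Y * b + Z * c) / (a ^ 2 + b ^ 2 + c ^ 2) * c := by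
    field_simp
    linear_combination a * n1 - b * n0
  have hv3 : ¬(v 0 = 0 ∧ v 1 = 0 ∧ v 2 = 0) := fun ⟨q0, q1, q2⟩ => hv0 <| by
    ext i
    fin_cases i <;> assumption
  refine ⟨v 0, v 1, v 2, (X * a + Y * b + Z * c) / (a ^ 2 + b ^ 2 + c ^ 2),
    by simpa using hv3, fun hμ => hv3 ?_, hXe, hYe, hZe⟩
  rw [hμ, zero_mul] at hXe hYe hZe
  exact eq_zero_of_hesse_quadrics_eq_zero h0 h6 hXe hYe hZe
end
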